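/- Let g ∈ S₀(ℝ), let α, β > 0 be such that (g, αℤ×βℤ) is a frame sequence with closed linear span 𝒢 = 𝒢(g, αℤ×βℤ) and canonical dual window γ, and let ν ∈ ℕ, ν ≥ 1. If T_{α/ν} g ∈ 𝒢, then for every s = 0, …, ν−1 one has (αβ)^{−1} ∑_{k,ℓ∈ℤ} ⟨M_{s/α} g, T_{k/β} M_{ℓν/α} γ⟩ T_{k/β} M_{ℓν/α} g = g if s = 0 and = 0 if s ≠ 0, where the sum converges unconditionally in L²(ℝ). -/

import Mathlib

open MeasureTheory Complex Filter
open scoped ENNReal InnerProductSpace RealInnerProductSpace ComplexConjugate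

noncomputable section

/-- The Hilbert space `L²(ℝ)` of complex-valued square-integrable functions. -/
abbrev L2 : Type := Lp ℂ 2 (volume : Measure ℝ)

lemma memLp_translate (a : ℝ) (f : L2) :
    MemLp (fun x : ℝ => f (x - a)) 2 (volume : Measure ℝ) :=
  (Lp.memLp f).comp_measurePreserving (measurePreserving_sub_right volume a)

lemma memLp_modulate (b : ℝ) (f : L2) :
    MemLp (fun x : ℝ => Complex.exp (2 * Real.pi * Complex.I * (b * x)) * f x) 2
      (volume : Measure ℝ) := by
  refine MemLp.of_le (Lp.memLp f) ?_ ?_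
  · exact (Complex.continuous_exp.comp (by fun_prop)).aestronglyMeasurable.mul
      (Lp.aestronglyMeasurable f)
  · filter_upwards with x
    have : Complex.exp (2 * Real.pi * Complex.I * (b * x))
        = Complex.exp ((2 * Real.pi * (b * x) : ℝ) * Complex.I) := by
      push_cast; ring_nf
    rw [norm_mul, this, Complex.norm_exp_ofReal_mul_I, one_mul]

/-- Translation `T_a` on `L²(ℝ)`: `(T_a f)(x) = f (x - a)`. -/
def Tr (a : ℝ) (f : L2) : L2 := (memLp_translate a f).toLp _

/-- Modulation `M_b` on `L²(ℝ)`: `(M_b f)(x) = e^{2πibx} f x`. -/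
def Mo (b : ℝ) (f : L2) : L2 := (memLp_modulate b f).toLp _

/-- Time-frequency shift `π(a,b) = T_a M_b`. -/
def tf (z : ℝ × ℝ) (f : L2) : L2 := Tr z.1 (Mo z.2 f)

/-- The closed linear span `𝒢(g,Λ)` of the Gabor system `(g,Λ)`. -/
def gaborSpan (g : L2) (Λ : Set (ℝ × ℝ)) : Set L2 :=
  closure (Submodule.span ℂ ((fun z => tf z g) '' Λ) : Set L2)

/-- `𝔍(𝒢)`: the set of time-frequency shifts leaving `𝒢` invariant. -/
def stab (G : Set L2) : Set (ℝ × ℝ) := {z | ∀ f ∈ G, tf z f ∈ G}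

/-- `Λ` is a lattice in `ℝ²` if `Λ = Aℤ²` for an invertible `2×2` matrix `A`. -/
def IsLattice (Λ : Set (ℝ × ℝ)) : Prop :=
  ∃ A : Matrix (Fin 2) (Fin 2) ℝ, IsUnit A.det ∧
    Λ = {p : ℝ × ℝ | ∃ k l : ℤ,
      p = (A 0 0 * k + A 0 1 * l, A 1 0 * k + A 1 1 * l)}

lemma memLp_gaussian : MemLp (fun x : ℝ => (Real.exp (-Real.pi * x ^ 2) : ℂ)) 2
    (volume : Measure ℝ) := by
  rw [memLp_two_iff_integrable_sq_norm]
  · have h : Integrable (fun x : ℝ => Real.exp (-(2 * Real.pi) * x ^ 2)) volume :=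
      integrable_exp_neg_mul_sq (by positivity)
    refine h.congr (Eventually.of_forall fun x => ?_)
    simp only [Complex.norm_real, Real.norm_eq_abs, Real.abs_exp, sq, ← Real.exp_add]
    ring_nf
  · exact (Complex.continuous_ofReal.comp (by fun_prop)).aestronglyMeasurable

/-- The Gaussian `φ(x) = e^{-πx²}` as an element of `L²(ℝ)`. -/
def gaussL2 : L2 := memLp_gaussian.toLp _

/-- The Feichtinger algebra condition: `f ∈ S₀(ℝ)` iff `(a,b) ↦ ⟨f, π(a,b)φ⟩ ∈ L¹(ℝ²)`. -/
def InS0 (f : L2) : Prop :=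
  Integrable (fun z : ℝ × ℝ => ⟪tf z gaussL2, f⟫_ℂ) (volume : Measure (ℝ × ℝ))

/-- `(g,Λ)` is a frame for its closed linear span. -/
def IsFrameSeq (g : L2) (Λ : Set (ℝ × ℝ)) : Prop :=
  ∃ A B : ℝ, 0 < A ∧ 0 < B ∧ ∀ f ∈ gaborSpan g Λ,
    A * ‖f‖ ^ 2 ≤ ∑' lam : Λ, ‖⟪tf (lam : ℝ × ℝ) g, f⟫_ℂ‖ ^ 2 ∧
    ∑' lam : Λ, ‖⟪tf (lam : ℝ × ℝ) g, f⟫_ℂ‖ ^ 2 ≤ B * ‖f‖ ^ 2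

/-- `(g,Λ)` is a frame for all of `L²(ℝ)`. -/
def IsFrameL2 (g : L2) (Λ : Set (ℝ × ℝ)) : Prop :=
  ∃ A B : ℝ, 0 < A ∧ 0 < B ∧ ∀ f : L2,
    A * ‖f‖ ^ 2 ≤ ∑' lam : Λ, ‖⟪tf (lam : ℝ × ℝ) g, f⟫_ℂ‖ ^ 2 ∧
    ∑' lam : Λ, ‖⟪tf (lam : ℝ × ℝ) g, f⟫_ℂ‖ ^ 2 ≤ B * ‖f‖ ^ 2

/-- Euclidean ball of radius `ε` around `a ∈ ℝ²`. -/
def eball (ε : ℝ) (a : ℝ × ℝ) : Set (ℝ × ℝ) :=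
  {x : ℝ × ℝ | Real.sqrt ((x.1 - a.1) ^ 2 + (x.2 - a.2) ^ 2) < ε}

/-- `B_ε(Δ) = ⋃_{a ∈ Δ} B_ε(a)`. -/
def eballSet (ε : ℝ) (Δ : Set (ℝ × ℝ)) : Set (ℝ × ℝ) := ⋃ a ∈ Δ, eball ε a

/-- The separable lattice `αℤ × βℤ`. -/
def sepLattice (α β : ℝ) : Set (ℝ × ℝ) :=
  {p : ℝ × ℝ | ∃ k l : ℤ, p = (α * k, β * l)}

/-- `γ` is the canonical dual window of the frame sequence `(g, αℤ×βℤ)`: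
`γ` belongs to `𝒢(g, αℤ×βℤ)` and `Sγ = g` for the frame operator `S`,
the defining series converging unconditionally in `L²`. -/
def IsDualWindow (g γ : L2) (α β : ℝ) : Prop :=
  γ ∈ gaborSpan g (sepLattice α β) ∧
  HasSum (fun lam : sepLattice α β =>
    ⟪tf (lam : ℝ × ℝ) g, γ⟫_ℂ • tf (lam : ℝ × ℝ) g) g

section Bessel

variable {H : Type*} [NormedAddCommGroup H] [InnerProductSpace ℂ H] {ι κ : Type*}

/-- A family `v` is a Bessel family with bound `B`. -/
structure IsBessel (v : ι → H) (B : ℝ) : Prop where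
  nonneg : 0 ≤ B
  bound : ∀ (s : Finset ι) (u : H), ∑ i ∈ s, ‖⟪v i, u⟫_ℂ‖ ^ 2 ≤ B * ‖u‖ ^ 2

lemma IsBessel.norm_sum_sq_le {v : ι → H} {B : ℝ} (h : IsBessel v B) (s : Finset ι)
    (c : ι → ℂ) : ‖∑ i ∈ s, c i • v i‖ ^ 2 ≤ B * ∑ i ∈ s, ‖c i‖ ^ 2 := by
  set u := ∑ i ∈ s, c i • v i with hu
  have h1 : ‖u‖ ^ 2 ≤ ∑ i ∈ s, ‖c i‖ * ‖⟪v i, u⟫_ℂ‖ := by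
    have : ⟪u, u⟫_ℂ = ∑ i ∈ s, conj (c i) * ⟪v i, u⟫_ℂ := by
      conv_lhs => rw [hu, sum_inner]
      simp [inner_smul_left, ← hu]
    calc ‖u‖ ^ 2 = ‖⟪u, u⟫_ℂ‖ := by rw [inner_self_eq_norm_sq_to_K]; simp
      _ ≤ _ := by
        rw [this]
        refine (norm_sum_le _ _).trans (Finset.sum_le_sum fun i _ => ?_)
        simp
  have h2 := Finset.sum_mul_sq_le_sq_mul_sq s (fun i => ‖c i‖) (fun i => ‖⟪v i, u⟫_ℂ‖)
  have h3 := h.bound s u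
  have h4 : 0 ≤ ∑ i ∈ s, ‖c i‖ ^ 2 := Finset.sum_nonneg fun i _ => by positivity
  have h5 : (‖u‖ ^ 2) ^ 2 ≤ (B * ∑ i ∈ s, ‖c i‖ ^ 2) * ‖u‖ ^ 2 :=
    calc (‖u‖ ^ 2) ^ 2 ≤ (∑ i ∈ s, ‖c i‖ * ‖⟪v i, u⟫_ℂ‖) ^ 2 := by gcongr
      _ ≤ _ := h2
      _ ≤ (∑ i ∈ s, ‖c i‖ ^ 2) * (B * ‖u‖ ^ 2) := by gcongr
      _ = _ := by ring
  rcases (sq_nonneg ‖u‖).eq_or_lt with h0 | h0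
  · rw [← h0]
    exact mul_nonneg h.nonneg h4
  · rw [pow_two (‖u‖ ^ 2)] at h5
    exact le_of_mul_le_mul_right h5 h0

lemma IsBessel.of_norm_sum_sq_le {v : ι → H} {B : ℝ} (hB : 0 ≤ B)
    (h : ∀ (s : Finset ι) (c : ι → ℂ), ‖∑ i ∈ s, c i • v i‖ ^ 2 ≤ B * ∑ i ∈ s, ‖c i‖ ^ 2) :
    IsBessel v B := by
  refine ⟨hB, fun s u => ?_⟩
  have hs := h s fun i => ⟪v i, u⟫_ℂ
  set N := ∑ i ∈ s, ‖⟪v i, u⟫_ℂ‖ ^ 2 with hN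
  set w := ∑ i ∈ s, ⟪v i, u⟫_ℂ • v i with hw
  have h1 : N = ‖⟪w, u⟫_ℂ‖ := by
    have : ⟪w, u⟫_ℂ = ((N : ℝ) : ℂ) := by
      rw [hw, sum_inner, hN]
      push_cast
      refine Finset.sum_congr rfl fun i _ => ?_
      rw [inner_smul_left, Complex.conj_mul']
    rw [this, Complex.norm_real, Real.norm_of_nonneg]
    exact Finset.sum_nonneg fun i _ => by positivity
  have h2 : N ≤ ‖w‖ * ‖u‖ := h1 ▸ norm_inner_le_norm w u
  have h3 : 0 ≤ N := Finset.sum_nonneg fun i _ => by positivity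
  have h4 : N * N ≤ (B * ‖u‖ ^ 2) * N :=
    calc N * N ≤ (‖w‖ * ‖u‖) * (‖w‖ * ‖u‖) := by gcongr
      _ = ‖w‖ ^ 2 * ‖u‖ ^ 2 := by ring
      _ ≤ (B * N) * ‖u‖ ^ 2 := by gcongr
      _ = _ := by ring
  rcases h3.eq_or_lt with h0 | h0
  · rw [← h0]; positivity
  · exact le_of_mul_le_mul_right h4 h0

lemma IsBessel.summable_sq {v : ι → H} {B : ℝ} (h : IsBessel v B) (u : H) :
    Summable fun i => ‖⟪v i, u⟫_ℂ‖ ^ 2 :=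
  summable_of_sum_le (fun _ => by positivity) fun s => h.bound s u

lemma IsBessel.summable_smul [CompleteSpace H] {v : ι → H} {B : ℝ} (h : IsBessel v B)
    {c : ι → ℂ} (hc : Summable fun i => ‖c i‖ ^ 2) : Summable fun i => c i • v i := by
  rw [summable_iff_vanishing_norm]
  intro ε hε
  obtain ⟨s, hs⟩ := summable_iff_vanishing_norm.1 hc (ε ^ 2 / (B + 1))
    (div_pos (by positivity) (by linarith [h.nonneg]))
  refine ⟨s, fun t ht => ?_⟩
  have h1 := hs t ht
  have h2 := h.norm_sum_sq_le t c
  rw [Real.norm_of_nonneg (Finset.sum_nonneg fun i _ => by positivity),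
    lt_div_iff₀ (by linarith [h.nonneg])] at h1
  have h3 : 0 ≤ ∑ i ∈ t, ‖c i‖ ^ 2 := Finset.sum_nonneg fun i _ => by positivity
  exact lt_of_pow_lt_pow_left₀ 2 hε.le (by linarith)

/-- The mixed frame operator `f ↦ ∑ ⟨f, w i⟩ v i` of two Bessel families is bounded. -/
lemma IsBessel.exists_frameOp [CompleteSpace H] {v w : ι → H} {B C : ℝ} (hv : IsBessel v B)
    (hw : IsBessel w C) :
    ∃ S : H →L[ℂ] H, ∀ f, HasSum (fun i => ⟪w i, f⟫_ℂ • v i) (S f) := by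
  have hs : ∀ f, HasSum (fun i => ⟪w i, f⟫_ℂ • v i) (∑' i, ⟪w i, f⟫_ℂ • v i) := fun f =>
    (hv.summable_smul (hw.summable_sq f)).hasSum
  let L : H →ₗ[ℂ] H :=
    { toFun := fun f => ∑' i, ⟪w i, f⟫_ℂ • v i
      map_add' := fun f g => by
        refine HasSum.unique (hs _) ?_
        simpa only [inner_add_right, add_smul] using (hs f).add (hs g)
      map_smul' := fun a f => by
        refine HasSum.unique (hs _) ?_
        simpa only [inner_smul_right, mul_smul, RingHom.id_apply] using (hs f).const_smul a }
  refine ⟨L.mkContinuous (Real.sqrt (B * C)) fun f => ?_, hs⟩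
  refine le_of_tendsto (hs f).norm (Eventually.of_forall fun s => ?_)
  refine abs_le_of_sq_le_sq' ?_ (by positivity) |>.2
  rw [mul_pow, Real.sq_sqrt (mul_nonneg hv.nonneg hw.nonneg)]
  refine (hv.norm_sum_sq_le s _).trans ?_
  rw [mul_assoc]
  exact mul_le_mul_of_nonneg_left (hw.bound s f) hv.nonneg

lemma IsBessel.smul_unit {v w : ι → H} {B : ℝ} (h : IsBessel v B) (p : ι → ℂ)
    (hp : ∀ i, ‖p i‖ = 1) (hw : ∀ i, w i = p i • v i) : IsBessel w B := by
  refine ⟨h.nonneg, fun s u => ?_⟩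
  have : ∀ i, ‖⟪w i, u⟫_ℂ‖ = ‖⟪v i, u⟫_ℂ‖ := fun i => by
    rw [hw, inner_smul_left, norm_mul, RCLike.norm_conj, hp, one_mul]
  simpa only [this] using h.bound s u

lemma IsBessel.comp_injective {v : ι → H} {B : ℝ} (h : IsBessel v B) {e : κ → ι}
    (he : Function.Injective e) : IsBessel (fun k => v (e k)) B := by
  classical
  refine ⟨h.nonneg, fun s u => ?_⟩
  simpa [Finset.sum_image he.injOn] using h.bound (s.image e) u

lemma IsBessel.map_isometry {v : ι → H} {B : ℝ} (h : IsBessel v B) (U : H →L[ℂ] H)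
    (hU : ∀ f, ‖U f‖ = ‖f‖) : IsBessel (fun i => U (v i)) B := by
  refine .of_norm_sum_sq_le h.nonneg fun s c => ?_
  have : ∑ i ∈ s, c i • U (v i) = U (∑ i ∈ s, c i • v i) := by
    simp only [map_sum, map_smul]
  rw [this, hU]
  exact h.norm_sum_sq_le s c

/-- Schur's test for a family whose Gram matrix is dominated by a summable convolution kernel. -/
lemma IsBessel.of_summable_gram [AddGroup ι] {v : ι → H} {a : ι → ℝ} (ha : Summable a)
    (ha0 : ∀ i, 0 ≤ a i) (h : ∀ i j, ‖⟪v i, v j⟫_ℂ‖ ≤ a (j - i)) :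
    IsBessel v (∑' i, a i) := by
  refine .of_norm_sum_sq_le (tsum_nonneg ha0) fun s c => ?_
  have hrow : ∀ i, ∑ j ∈ s, a (j - i) ≤ ∑' i, a i := fun i => by
    have h1 : Summable fun j => a (j - i) := (Equiv.subRight i).summable_iff.2 ha
    refine (h1.sum_le_tsum s fun j _ => ha0 _).trans_eq ?_
    exact (Equiv.subRight i).tsum_eq a
  have hcol : ∀ j, ∑ i ∈ s, a (j - i) ≤ ∑' i, a i := fun j => by
    have h1 : Summable fun i => a (j - i) := (Equiv.subLeft j).summable_iff.2 ha
    refine (h1.sum_le_tsum s fun j _ => ha0 _).trans_eq ?_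
    exact (Equiv.subLeft j).tsum_eq a
  have h0 : ‖∑ i ∈ s, c i • v i‖ ^ 2 ≤ ∑ i ∈ s, ∑ j ∈ s, ‖c i‖ * ‖c j‖ * a (j - i) := by
    have : ‖∑ i ∈ s, c i • v i‖ ^ 2 = ‖⟪∑ i ∈ s, c i • v i, ∑ i ∈ s, c i • v i⟫_ℂ‖ := by
      rw [inner_self_eq_norm_sq_to_K]; simp
    rw [this, sum_inner]
    refine (norm_sum_le _ _).trans (Finset.sum_le_sum fun i _ => ?_)
    rw [inner_sum]
    refine (norm_sum_le _ _).trans (Finset.sum_le_sum fun j _ => ?_)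
    rw [inner_smul_left, inner_smul_right, norm_mul, norm_mul, RCLike.norm_conj, ← mul_assoc]
    exact mul_le_mul_of_nonneg_left (h i j) (by positivity)
  calc ‖∑ i ∈ s, c i • v i‖ ^ 2
      ≤ ∑ i ∈ s, ∑ j ∈ s, ‖c i‖ * ‖c j‖ * a (j - i) := h0
    _ ≤ ∑ i ∈ s, ∑ j ∈ s, (‖c i‖ ^ 2 / 2 * a (j - i) + ‖c j‖ ^ 2 / 2 * a (j - i)) := by
        refine Finset.sum_le_sum fun i _ => Finset.sum_le_sum fun j _ => ?_
        rw [← add_mul]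
        refine mul_le_mul_of_nonneg_right ?_ (ha0 _)
        nlinarith [sq_nonneg (‖c i‖ - ‖c j‖)]
    _ = ∑ i ∈ s, ‖c i‖ ^ 2 / 2 * ∑ j ∈ s, a (j - i)
        + ∑ j ∈ s, ‖c j‖ ^ 2 / 2 * ∑ i ∈ s, a (j - i) := by
        simp_rw [Finset.sum_add_distrib, Finset.mul_sum]
        congr 1
        exact Finset.sum_comm
    _ ≤ ∑ i ∈ s, ‖c i‖ ^ 2 / 2 * (∑' i, a i) + ∑ j ∈ s, ‖c j‖ ^ 2 / 2 * (∑' i, a i) := by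
        gcongr with i _ j _
        · exact hrow i
        · exact hcol j
    _ = (∑' i, a i) * ∑ i ∈ s, ‖c i‖ ^ 2 := by
        rw [← Finset.sum_mul, ← Finset.sum_div]; ring

end Bessel

section TimeFrequency

/-- The character `x ↦ e^{2πix}`. -/
def unitExp (x : ℝ) : ℂ := Complex.exp (2 * Real.pi * Complex.I * x)

lemma unitExp_add (x y : ℝ) : unitExp (x + y) = unitExp x * unitExp y := by
  rw [unitExp, unitExp, unitExp, ← Complex.exp_add]; push_cast; ring_nf

lemma unitExp_zero : unitExp 0 = 1 := by simp [unitExp]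

lemma norm_unitExp (x : ℝ) : ‖unitExp x‖ = 1 := by
  rw [unitExp, show (2 * Real.pi * Complex.I * x : ℂ) = (2 * Real.pi * x : ℝ) * Complex.I by
    push_cast; ring, Complex.norm_exp_ofReal_mul_I]

lemma conj_unitExp (x : ℝ) : conj (unitExp x) = unitExp (-x) := by
  rw [unitExp, unitExp, ← Complex.exp_conj]
  simp [map_ofNat]

lemma unitExp_neg_mul_self (x : ℝ) : unitExp (-x) * unitExp x = 1 := by
  rw [← unitExp_add, neg_add_cancel, unitExp_zero]

lemma unitExp_mul_neg_self (x : ℝ) : unitExp x * unitExp (-x) = 1 := by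
  rw [← unitExp_add, add_neg_cancel, unitExp_zero]

lemma unitExp_intCast (n : ℤ) : unitExp n = 1 := by
  rw [unitExp, Complex.exp_eq_one_iff]
  exact ⟨n, by push_cast; ring⟩

lemma continuous_unitExp : Continuous unitExp := by unfold unitExp; fun_prop

lemma Tr_coeFn (a : ℝ) (f : L2) : Tr a f =ᵐ[volume] fun x => f (x - a) :=
  MemLp.coeFn_toLp _

lemma Mo_coeFn (b : ℝ) (f : L2) : Mo b f =ᵐ[volume] fun x => unitExp (b * x) * f x := by
  filter_upwards [(memLp_modulate b f).coeFn_toLp] with x hx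
  rw [Mo, hx, unitExp]
  push_cast
  rfl

lemma ae_comp_sub {P : ℝ → Prop} (a : ℝ) (h : ∀ᵐ x ∂(volume : Measure ℝ), P x) :
    ∀ᵐ x ∂(volume : Measure ℝ), P (x - a) :=
  (measurePreserving_sub_right volume a).quasiMeasurePreserving.ae h

lemma tf_coeFn (z : ℝ × ℝ) (f : L2) :
    tf z f =ᵐ[volume] fun x => unitExp (z.2 * (x - z.1)) * f (x - z.1) := by
  filter_upwards [Tr_coeFn z.1 (Mo z.2 f), ae_comp_sub z.1 (Mo_coeFn z.2 f)] with x h1 h2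
  rw [tf, h1, h2]

lemma Tr_eq_tf (a : ℝ) (f : L2) : Tr a f = tf (a, 0) f := by
  apply Lp.ext
  filter_upwards [Tr_coeFn a f, tf_coeFn (a, 0) f] with x h1 h2
  rw [h1, h2]; simp [unitExp_zero]

lemma Mo_eq_tf (b : ℝ) (f : L2) : Mo b f = tf (0, b) f := by
  apply Lp.ext
  filter_upwards [Mo_coeFn b f, tf_coeFn (0, b) f] with x h1 h2
  rw [h1, h2]; simp

lemma norm_tf (z : ℝ × ℝ) (f : L2) : ‖tf z f‖ = ‖f‖ := by
  have h1 : ∀ (a : ℝ) (f : L2), ‖Tr a f‖ = ‖f‖ := fun a f => by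
    rw [Tr, Lp.norm_toLp, Lp.norm_def]
    congr 1
    exact eLpNorm_comp_measurePreserving (Lp.aestronglyMeasurable f)
      (measurePreserving_sub_right volume a)
  have h2 : ∀ (b : ℝ) (f : L2), ‖Mo b f‖ = ‖f‖ := fun b f => by
    rw [Lp.norm_def, Lp.norm_def]
    congr 1
    refine eLpNorm_congr_norm_ae ?_
    filter_upwards [Mo_coeFn b f] with x hx
    rw [hx, norm_mul, norm_unitExp, one_mul]
  rw [tf, h1, h2]

/-- The time-frequency shift as a bounded operator. -/
def tfL (z : ℝ × ℝ) : L2 →L[ℂ] L2 :=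
  LinearMap.mkContinuous
    { toFun := tf z
      map_add' := fun f g => by
        apply Lp.ext
        filter_upwards [tf_coeFn z (f + g), tf_coeFn z f, tf_coeFn z g,
          Lp.coeFn_add (tf z f) (tf z g), ae_comp_sub z.1 (Lp.coeFn_add f g)] with x h1 h2 h3 h4 h5
        rw [h1, h4, Pi.add_apply, h2, h3, h5, Pi.add_apply, mul_add]
      map_smul' := fun c f => by
        apply Lp.ext
        filter_upwards [tf_coeFn z (c • f), tf_coeFn z f,
          Lp.coeFn_smul c (tf z f), ae_comp_sub z.1 (Lp.coeFn_smul c f)] with x h1 h2 h3 h4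
        rw [h1, RingHom.id_apply, h3, Pi.smul_apply, h2, h4, Pi.smul_apply, smul_eq_mul,
          smul_eq_mul]
        ring } 1 fun f => by
    rw [one_mul]
    exact (norm_tf z f).le

@[simp] lemma tfL_apply (z : ℝ × ℝ) (f : L2) : tfL z f = tf z f := rfl

lemma tf_smul (z : ℝ × ℝ) (c : ℂ) (f : L2) : tf z (c • f) = c • tf z f := (tfL z).map_smul c f

lemma tf_sum {ι : Type*} (z : ℝ × ℝ) (s : Finset ι) (f : ι → L2) :
    tf z (∑ i ∈ s, f i) = ∑ i ∈ s, tf z (f i) := map_sum (tfL z) f s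

lemma tf_zero (f : L2) : tf 0 f = f := by
  apply Lp.ext
  filter_upwards [tf_coeFn 0 f] with x h1
  rw [h1]; simp [unitExp_zero]

lemma tf_tf (z w : ℝ × ℝ) (f : L2) : tf z (tf w f) = unitExp (z.2 * w.1) • tf (z + w) f := by
  apply Lp.ext
  filter_upwards [tf_coeFn z (tf w f), ae_comp_sub z.1 (tf_coeFn w f), tf_coeFn (z + w) f,
    Lp.coeFn_smul (unitExp (z.2 * w.1)) (tf (z + w) f)] with x h1 h2 h3 h4
  rw [h1, h2, h4, Pi.smul_apply, h3, smul_eq_mul, ← mul_assoc, ← mul_assoc, ← unitExp_add,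
    ← unitExp_add]
  simp only [Prod.fst_add, Prod.snd_add]
  congr 2 <;> ring_nf

lemma inner_tf_tf (z : ℝ × ℝ) (f g : L2) : ⟪tf z f, tf z g⟫_ℂ = ⟪f, g⟫_ℂ :=
  LinearIsometry.inner_map_map (⟨(tfL z).toLinearMap, norm_tf z⟩ : L2 →ₗᵢ[ℂ] L2) f g

/-- The inverse of a time-frequency shift. -/
def tfInv (z : ℝ × ℝ) : L2 →L[ℂ] L2 := unitExp (z.1 * z.2) • tfL (-z)

lemma tfInv_apply (z : ℝ × ℝ) (f : L2) : tfInv z f = unitExp (z.1 * z.2) • tf (-z) f := rfl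

lemma tf_tfInv (z : ℝ × ℝ) (f : L2) : tf z (tfInv z f) = f := by
  rw [tfInv_apply, tf_smul, tf_tf, smul_smul, add_neg_cancel, tf_zero, ← unitExp_add]
  simp [mul_comm, unitExp_zero]

lemma tfInv_tf (z : ℝ × ℝ) (f : L2) : tfInv z (tf z f) = f := by
  rw [tfInv_apply, tf_tf, smul_smul, neg_add_cancel, tf_zero, ← unitExp_add]
  simp [mul_comm, unitExp_zero]

lemma norm_tfInv (z : ℝ × ℝ) (f : L2) : ‖tfInv z f‖ = ‖f‖ := by
  rw [tfInv_apply, norm_smul, norm_unitExp, norm_tf, one_mul]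

lemma inner_tf_left (z : ℝ × ℝ) (f g : L2) : ⟪tf z f, g⟫_ℂ = ⟪f, tfInv z g⟫_ℂ := by
  conv_lhs => rw [← tf_tfInv z g, inner_tf_tf]

lemma inner_tf_right (z : ℝ × ℝ) (f g : L2) : ⟪f, tf z g⟫_ℂ = ⟪tfInv z f, g⟫_ℂ := by
  conv_lhs => rw [← tf_tfInv z f, inner_tf_tf]

lemma tf_comm (z w : ℝ × ℝ) (f : L2) :
    tf z (tf w f) = unitExp (z.2 * w.1 - w.2 * z.1) • tf w (tf z f) := by
  rw [tf_tf, tf_tf, smul_smul, ← unitExp_add, add_comm w z]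
  congr 2
  ring

lemma norm_inner_tf_tf (z w : ℝ × ℝ) (f g : L2) :
    ‖⟪tf z f, tf w g⟫_ℂ‖ = ‖⟪f, tf (w - z) g⟫_ℂ‖ := by
  rw [inner_tf_left, tfInv_apply, tf_tf, smul_smul, inner_smul_right, norm_mul, norm_mul,
    norm_unitExp, norm_unitExp, one_mul, one_mul, neg_add_eq_sub]

end TimeFrequency

section Poisson

open scoped ContDiff FourierTransform

lemma summable_integral_unitExp {F : ℝ → ℂ} (hc : HasCompactSupport F) (hs : ContDiff ℝ ∞ F)
    {b : ℝ} (hb : 0 < b) :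
    Summable fun l : ℤ => ‖∫ x, unitExp (-(b * l * x)) * F x‖ := by
  have h1 := ((𝓕 (hc.toSchwartzMap hs)).isBigO_cocompact_rpow (-2))
  have h2 : Tendsto (fun l : ℤ => b * (l : ℝ)) cofinite (cocompact ℝ) :=
    (Homeomorph.mulLeft₀ b hb.ne').isClosedEmbedding.tendsto_cocompact.comp
      Int.tendsto_coe_cofinite
  have h3 := (h1.comp_tendsto h2).norm_left
  have h4 : Summable fun l : ℤ => ‖b * (l : ℝ)‖ ^ (-2 : ℝ) := by
    have := (Real.summable_abs_int_rpow (b := 2) one_lt_two).mul_left (b ^ (-2 : ℝ))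
    refine this.congr fun l => ?_
    rw [norm_mul, Real.norm_of_nonneg hb.le, Real.norm_eq_abs,
      Real.mul_rpow hb.le (abs_nonneg _)]
  refine (summable_of_isBigO h4 h3).congr fun l => ?_
  simp only [Function.comp_apply]
  rw [SchwartzMap.fourier_coe, Real.fourier_real_eq_integral_exp_smul]
  congr 2 with x
  rw [unitExp, smul_eq_mul]
  congr 2
  push_cast
  ring

lemma hasSum_poisson {F : ℝ → ℂ} (hc : HasCompactSupport F) (hs : ContDiff ℝ ∞ F)
    {b : ℝ} (hb : 0 < b) (y : ℝ) :
    HasSum (fun l : ℤ => (∫ x, unitExp (-(b * l * x)) * F x) * unitExp (b * l * y))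
      ((b⁻¹ : ℝ) * ∑' k : ℤ, F (y + b⁻¹ * k)) := by
  have hsum : Summable fun l : ℤ =>
      (∫ x, unitExp (-(b * l * x)) * F x) * unitExp (b * l * y) := by
    refine Summable.of_norm ((summable_integral_unitExp hc hs hb).congr fun l => ?_)
    rw [norm_mul, norm_unitExp, mul_one]
  convert hsum.hasSum using 1
  have hc' : HasCompactSupport fun x => F (b⁻¹ * x) :=
    hc.comp_homeomorph (Homeomorph.mulLeft₀ b⁻¹ (inv_ne_zero hb.ne'))
  have hs' : ContDiff ℝ ∞ fun x => F (b⁻¹ * x) := hs.comp (by fun_prop)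
  have h := (hc'.toSchwartzMap hs').tsum_eq_tsum_fourier (b * y)
  have h1 : ∀ k : ℤ, (hc'.toSchwartzMap hs') (b * y + k) = F (y + b⁻¹ * k) := fun k => by
    change F (b⁻¹ * (b * y + k)) = _
    congr 1
    field_simp
  simp_rw [h1] at h
  rw [h, ← tsum_mul_left]
  refine tsum_congr fun l => ?_
  rw [SchwartzMap.fourier_coe, Real.fourier_real_eq_integral_exp_smul, fourier_coe_apply]
  have h2 := Measure.integral_comp_mul_left
    (fun x => unitExp (-(b * l * x)) * F x) b⁻¹
  rw [inv_inv, abs_of_pos hb] at h2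
  have h3 : ∫ x : ℝ, Complex.exp (↑(-2 * Real.pi * x * l) * I) • (hc'.toSchwartzMap hs') x
      = ∫ x, unitExp (-(b * l * (b⁻¹ * x))) * F (b⁻¹ * x) := by
    congr 1 with x
    rw [unitExp, smul_eq_mul, show b * l * (b⁻¹ * x) = l * x by field_simp]
    congr 2
    push_cast
    ring
  rw [h3, h2, real_smul, ← mul_assoc, ← mul_assoc, ← ofReal_mul, inv_mul_cancel₀ hb.ne',
    ofReal_one, one_mul, unitExp]
  congr 2
  push_cast
  ring

lemma exists_finset_mul_shift_eq_zero {u F : ℝ → ℂ} (hu : HasCompactSupport u)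
    (hF : HasCompactSupport F) {a : ℝ} (ha : 0 < a) :
    ∃ S : Finset ℤ, ∀ k ∉ S, ∀ y, u y * F (y + a * k) = 0 := by
  obtain ⟨R, hR⟩ := hu.isCompact.isBounded.exists_norm_le
  obtain ⟨Q, hQ⟩ := hF.isCompact.isBounded.exists_norm_le
  refine ⟨Finset.Icc (-⌈(R + Q) / a⌉) ⌈(R + Q) / a⌉, fun k hk y => ?_⟩
  by_contra h
  have h1 := hR y (subset_tsupport _ (left_ne_zero_of_mul h))
  have h2 := hQ _ (subset_tsupport _ (right_ne_zero_of_mul h))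
  rw [Real.norm_eq_abs, abs_le] at h1 h2
  apply hk
  have h3 : (k : ℝ) ≤ (R + Q) / a := by
    rw [le_div_iff₀ ha]; nlinarith
  have h4 : -(k : ℝ) ≤ (R + Q) / a := by
    rw [le_div_iff₀ ha]; nlinarith
  have h5 := Int.le_ceil ((R + Q) / a)
  rw [Finset.mem_Icc]
  constructor
  · have : -(k : ℝ) ≤ (⌈(R + Q) / a⌉ : ℝ) := h4.trans h5
    have : -k ≤ ⌈(R + Q) / a⌉ := by exact_mod_cast this
    linarith
  · exact_mod_cast h3.trans h5

lemma hasSum_poisson_integral {F u : ℝ → ℂ} (hc : HasCompactSupport F) (hs : ContDiff ℝ ∞ F)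
    (huc : HasCompactSupport u) (hu : Continuous u) {b : ℝ} (hb : 0 < b) :
    HasSum (fun l : ℤ =>
        (∫ x, unitExp (-(b * l * x)) * F x) * ∫ y, unitExp (b * l * y) * u y)
      ((b⁻¹ : ℝ) * ∑' k : ℤ, ∫ y, u y * F (y + b⁻¹ * k)) := by
  obtain ⟨S, hS⟩ := exists_finset_mul_shift_eq_zero huc hc (inv_pos.2 hb)
  have hui : Integrable u := hu.integrable_of_hasCompactSupport huc
  have hint : ∀ l : ℤ, Integrable fun y =>
      (∫ x, unitExp (-(b * l * x)) * F x) * (unitExp (b * l * y) * u y) := fun l => by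
    refine Integrable.const_mul ?_ _
    refine hui.bdd_mul (c := 1) ?_ ?_
    · exact (continuous_unitExp.comp (by fun_prop)).aestronglyMeasurable
    · exact Eventually.of_forall fun y => (norm_unitExp _).le
  have hnorm : Summable fun l : ℤ => ∫ y,
      ‖(∫ x, unitExp (-(b * l * x)) * F x) * (unitExp (b * l * y) * u y)‖ := by
    simp_rw [norm_mul, norm_unitExp, one_mul, integral_const_mul]
    exact (summable_integral_unitExp hc hs hb).mul_right _
  have h := hasSum_integral_of_summable_integral_norm hint hnorm
  simp_rw [integral_const_mul] at h
  suffices heq : ∫ y, ∑' l : ℤ, (∫ x, unitExp (-(b * l * x)) * F x) * (unitExp (b * l * y) * u y)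
      = ((b⁻¹ : ℝ) : ℂ) * ∑' k : ℤ, ∫ y, u y * F (y + b⁻¹ * k) from heq ▸ h
  have h1 : ∀ y, ∑' l : ℤ, (∫ x, unitExp (-(b * l * x)) * F x) * (unitExp (b * l * y) * u y)
      = ((b⁻¹ : ℝ) : ℂ) * ∑ k ∈ S, u y * F (y + b⁻¹ * k) := fun y => by
    have h0 : ∑' k : ℤ, u y * F (y + b⁻¹ * k) = ∑ k ∈ S, u y * F (y + b⁻¹ * k) :=
      tsum_eq_sum fun k hk => hS k hk y
    rw [← h0, tsum_mul_left, mul_left_comm,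
      ← (hasSum_poisson hc hs hb y).tsum_eq, ← tsum_mul_left]
    refine tsum_congr fun l => ?_
    ring
  refine (integral_congr_ae (Eventually.of_forall h1)).trans ?_
  rw [integral_const_mul, integral_finsetSum, tsum_eq_sum]
  · intro k hk
    simp [hS k hk]
  · intro k _
    refine Continuous.integrable_of_hasCompactSupport ?_ huc.mul_right
    exact hu.mul (hs.continuous.comp (by fun_prop))

lemma summable_prod_of_finset {f : ℤ × ℤ → ℂ} (S : Finset ℤ) (h0 : ∀ k ∉ S, ∀ l, f (k, l) = 0)
    (h : ∀ k, Summable fun l => ‖f (k, l)‖) : Summable fun n => ‖f n‖ := by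
  rw [summable_prod_of_nonneg fun _ => norm_nonneg _]
  refine ⟨h, summable_of_ne_finset_zero (s := S) fun k hk => ?_⟩
  simp [h0 k hk]

end Poisson

section TestFunctions

open scoped ContDiff

/-- The points `(a k, b l)` of a separable lattice, indexed by `ℤ × ℤ`. -/
def latPt (a b : ℝ) (n : ℤ × ℤ) : ℝ × ℝ := (a * n.1, b * n.2)

lemma latPt_add (a b : ℝ) (m n : ℤ × ℤ) : latPt a b (m + n) = latPt a b m + latPt a b n := by
  simp [latPt, mul_add]

lemma latPt_neg (a b : ℝ) (n : ℤ × ℤ) : latPt a b (-n) = -latPt a b n := by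
  simp [latPt]

lemma latPt_sub (a b : ℝ) (m n : ℤ × ℤ) : latPt a b (m - n) = latPt a b m - latPt a b n := by
  simp [latPt, mul_sub]

/-- `f ∈ L²(ℝ)` has a smooth compactly supported representative `F`. -/
structure IsTestRep (f : L2) (F : ℝ → ℂ) : Prop where
  ae_eq : f =ᵐ[volume] F
  compact : HasCompactSupport F
  smooth : ContDiff ℝ ∞ F

/-- `f ∈ L²(ℝ)` is represented by a smooth compactly supported function. -/
def IsTest (f : L2) : Prop := ∃ F : ℝ → ℂ, IsTestRep f F

lemma dense_isTest : Dense {f : L2 | IsTest f} := by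
  refine (Lp.dense_hasCompactSupport_contDiff (F := ℂ) (E := ℝ) (μ := volume) (p := 2)
    (by simp)).mono ?_
  rintro f ⟨F, h1, h2, h3⟩
  exact ⟨F, h1, h2, h3⟩

lemma IsTest.add {f g : L2} (hf : IsTest f) (hg : IsTest g) : IsTest (f + g) := by
  obtain ⟨F, hF⟩ := hf
  obtain ⟨G, hG⟩ := hg
  exact ⟨F + G, (Lp.coeFn_add f g).trans (hF.ae_eq.add hG.ae_eq), hF.compact.add hG.compact,
    hF.smooth.add hG.smooth⟩

lemma IsTest.smul {f : L2} (hf : IsTest f) (c : ℂ) : IsTest (c • f) := by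
  obtain ⟨F, hF⟩ := hf
  refine ⟨fun x => c * F x, ?_, hF.compact.mul_left, contDiff_const.mul hF.smooth⟩
  filter_upwards [Lp.coeFn_smul c f, hF.ae_eq] with x h1 h2
  rw [h1, Pi.smul_apply, h2, smul_eq_mul]

lemma isTest_zero : IsTest 0 :=
  ⟨0, Lp.coeFn_zero _ _ _, HasCompactSupport.zero, contDiff_const⟩

lemma IsTest.sum {ι : Type*} {f : ι → L2} (s : Finset ι) (hf : ∀ i, IsTest (f i)) :
    IsTest (∑ i ∈ s, f i) :=
  Finset.sum_induction f IsTest (fun _ _ => IsTest.add) isTest_zero fun i _ => hf i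

lemma HasCompactSupport.comp_sub_const {F : ℝ → ℂ} (hF : HasCompactSupport F) (a : ℝ) :
    HasCompactSupport fun x => F (x - a) :=
  hF.comp_homeomorph (Homeomorph.subRight a)

lemma HasCompactSupport.conj {F : ℝ → ℂ} (hF : HasCompactSupport F) :
    HasCompactSupport fun x => conj (F x) :=
  hF.comp_left (map_zero _)

lemma contDiff_conj_comp {F : ℝ → ℂ} (hF : ContDiff ℝ ∞ F) :
    ContDiff ℝ ∞ fun x => conj (F x) :=
  Complex.conjCLE.contDiff.comp hF

lemma contDiff_unitExp : ContDiff ℝ ∞ unitExp := by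
  unfold unitExp
  exact Complex.contDiff_exp.comp (contDiff_const.mul Complex.ofRealCLM.contDiff)

lemma IsTest.shift {f : L2} (hf : IsTest f) (z : ℝ × ℝ) : IsTest (tf z f) := by
  obtain ⟨F, hF⟩ := hf
  refine ⟨fun x => unitExp (z.2 * (x - z.1)) * F (x - z.1), ?_, ?_, ?_⟩
  · filter_upwards [tf_coeFn z f, ae_comp_sub z.1 hF.ae_eq] with x h1 h2
    rw [h1, h2]
  · exact (hF.compact.comp_sub_const z.1).mul_left
  · exact (contDiff_unitExp.comp (by fun_prop)).mul (hF.smooth.comp (by fun_prop))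

lemma inner_tf_left_eq_integral {f g : L2} {F G : ℝ → ℂ} (hF : IsTestRep f F)
    (hG : IsTestRep g G) (a b : ℝ) :
    ⟪tf (a, b) f, g⟫_ℂ = unitExp (b * a) * ∫ x, unitExp (-(b * x)) * (conj (F (x - a)) * G x) := by
  rw [L2.inner_def, ← integral_const_mul]
  refine integral_congr_ae ?_
  filter_upwards [tf_coeFn (a, b) f, ae_comp_sub a hF.ae_eq, hG.ae_eq] with x h1 h2 h3
  rw [RCLike.inner_apply, h1, h2, h3, map_mul, conj_unitExp,
    show -(b * (x - a)) = b * a + -(b * x) by ring, unitExp_add]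
  ring

lemma inner_tf_right_eq_integral {f g : L2} {F G : ℝ → ℂ} (hF : IsTestRep f F)
    (hG : IsTestRep g G) (a b : ℝ) :
    ⟪g, tf (a, b) f⟫_ℂ = unitExp (-(b * a)) * ∫ x, unitExp (b * x) * (conj (G x) * F (x - a)) := by
  rw [L2.inner_def, ← integral_const_mul]
  refine integral_congr_ae ?_
  filter_upwards [tf_coeFn (a, b) f, ae_comp_sub a hF.ae_eq, hG.ae_eq] with x h1 h2 h3
  rw [RCLike.inner_apply, h1, h2, h3, show b * (x - a) = -(b * a) + b * x by ring, unitExp_add]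
  ring

lemma exists_finset_inner_tf_eq_zero {f g : L2} (hf : IsTest f) (hg : IsTest g) {a : ℝ}
    (ha : 0 < a) : ∃ S : Finset ℤ, ∀ k ∉ S, ∀ b : ℝ, ⟪g, tf (a * k, b) f⟫_ℂ = 0 := by
  obtain ⟨F, hF⟩ := hf
  obtain ⟨G, hG⟩ := hg
  obtain ⟨S, hS⟩ := exists_finset_mul_shift_eq_zero hF.compact hG.compact.conj ha
  refine ⟨S, fun k hk b => ?_⟩
  rw [inner_tf_right_eq_integral hF hG]
  have : ∀ x, conj (G x) * F (x - a * k) = 0 := fun x => by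
    have := hS k hk (x - a * k)
    rwa [sub_add_cancel, mul_comm] at this
  simp [this]

lemma IsTest.summable_inner {f g : L2} (hf : IsTest f) (hg : IsTest g) {a b : ℝ}
    (ha : 0 < a) (hb : 0 < b) : Summable fun n => ‖⟪g, tf (latPt a b n) f⟫_ℂ‖ := by
  obtain ⟨S, hS⟩ := exists_finset_inner_tf_eq_zero hf hg ha
  refine summable_prod_of_finset S (fun k hk l => hS k hk _) fun k => ?_
  obtain ⟨F, hF⟩ := hf
  obtain ⟨G, hG⟩ := hg
  have hc : HasCompactSupport fun x => conj (F (x - a * k)) * G x := hG.compact.mul_left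
  have hs : ContDiff ℝ ∞ fun x => conj (F (x - a * k)) * G x :=
    (contDiff_conj_comp (hF.smooth.comp (by fun_prop))).mul hG.smooth
  refine (summable_integral_unitExp hc hs hb).congr fun l => ?_
  rw [norm_inner_symm, latPt, inner_tf_left_eq_integral hF hG, norm_mul, norm_unitExp, one_mul]

lemma IsTest.exists_isBessel {f : L2} (hf : IsTest f) {a b : ℝ} (ha : 0 < a) (hb : 0 < b) :
    ∃ B, IsBessel (fun n => tf (latPt a b n) f) B :=
  ⟨_, .of_summable_gram (hf.summable_inner hf ha hb) (fun _ => norm_nonneg _) fun i j => by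
    rw [norm_inner_tf_tf, ← latPt_sub]⟩

/-- The fundamental identity of Gabor analysis for smooth compactly supported functions. -/
lemma tsum_inner_eq_of_isTest {α β : ℝ} (hα : 0 < α) (hβ : 0 < β) {f h g γ : L2}
    (hf : IsTest f) (hh : IsTest h) (hg : IsTest g) (hγ : IsTest γ) :
    ∑' n, ⟪tf (latPt α β n) γ, f⟫_ℂ * ⟪h, tf (latPt α β n) g⟫_ℂ =
      ((α * β)⁻¹ : ℝ) * ∑' n, ⟪tf (latPt β⁻¹ α⁻¹ n) γ, g⟫_ℂ * ⟪h, tf (latPt β⁻¹ α⁻¹ n) f⟫_ℂ := by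
  have hα' := inv_pos.2 hα
  have hβ' := inv_pos.2 hβ
  have bdd : ∀ {u v x y : L2} {a b : ℝ}, IsTest x → IsTest y → 0 < a → 0 < b →
      Summable fun n => ⟪tf (latPt a b n) u, v⟫_ℂ * ⟪y, tf (latPt a b n) x⟫_ℂ := by
    intro u v x y a b hx hy ha hb
    refine Summable.of_norm_bounded ((hx.summable_inner hy ha hb).mul_left (‖u‖ * ‖v‖))
      fun n => ?_
    rw [norm_mul]
    refine mul_le_mul_of_nonneg_right ?_ (norm_nonneg _)
    exact (norm_inner_le_norm _ _).trans_eq (by rw [norm_tf])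
  have hL : Summable fun n => ⟪tf (latPt α β n) γ, f⟫_ℂ * ⟪h, tf (latPt α β n) g⟫_ℂ :=
    bdd hg hh hα hβ
  have hR : Summable fun n : ℤ × ℤ => ⟪tf (latPt β⁻¹ α⁻¹ (-n)) γ, g⟫_ℂ *
      ⟪h, tf (latPt β⁻¹ α⁻¹ (-n)) f⟫_ℂ :=
    (Equiv.neg (ℤ × ℤ)).summable_iff.2 (bdd hf hh hβ' hα')
  rw [← (Equiv.neg (ℤ × ℤ)).tsum_eq fun n => ⟪tf (latPt β⁻¹ α⁻¹ n) γ, g⟫_ℂ *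
    ⟪h, tf (latPt β⁻¹ α⁻¹ n) f⟫_ℂ]
  simp only [Equiv.neg_apply]
  rw [hL.tsum_prod, hR.tsum_prod]
  obtain ⟨F, hF⟩ := hf
  obtain ⟨K, hK⟩ := hh
  obtain ⟨G, hG⟩ := hg
  obtain ⟨Γ, hΓ⟩ := hγ
  let J : ℤ → ℤ → ℂ := fun k j =>
    ∫ y, conj (K y) * G (y - α * k) * (conj (Γ (y + β⁻¹ * j - α * k)) * F (y + β⁻¹ * j))
  have h1 : ∀ k : ℤ, ∑' l : ℤ, ⟪tf (latPt α β (k, l)) γ, f⟫_ℂ * ⟪h, tf (latPt α β (k, l)) g⟫_ℂ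
      = (β⁻¹ : ℝ) * ∑' j : ℤ, J k j := fun k => by
    have := hasSum_poisson_integral (F := fun x => conj (Γ (x - α * k)) * F x)
      (u := fun y => conj (K y) * G (y - α * k)) hF.compact.mul_left
      ((contDiff_conj_comp (hΓ.smooth.comp (by fun_prop))).mul hF.smooth)
      hK.compact.conj.mul_right
      ((contDiff_conj_comp hK.smooth).mul (hG.smooth.comp (by fun_prop))).continuous hβ
    rw [← this.tsum_eq]
    refine tsum_congr fun l => ?_
    rw [latPt, inner_tf_left_eq_integral hΓ hF, inner_tf_right_eq_integral hG hK,
      mul_mul_mul_comm, unitExp_mul_neg_self, one_mul]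
  have h2 : ∀ j : ℤ, ∑' l : ℤ, ⟪tf (latPt β⁻¹ α⁻¹ (-(j, l))) γ, g⟫_ℂ *
      ⟪h, tf (latPt β⁻¹ α⁻¹ (-(j, l))) f⟫_ℂ = (α : ℝ) * ∑' k : ℤ, J k j := fun j => by
    have := hasSum_poisson_integral (F := fun x => conj (K x) * F (x + β⁻¹ * j))
      (u := fun y => conj (Γ (y + β⁻¹ * j)) * G y) hK.compact.conj.mul_right
      ((contDiff_conj_comp hK.smooth).mul (hF.smooth.comp (by fun_prop)))
      hG.compact.mul_left
      ((contDiff_conj_comp (hΓ.smooth.comp (by fun_prop))).mul hG.smooth).continuous hα'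
    rw [inv_inv] at this
    have hJ : ∀ k : ℤ, J k j = ∫ y, conj (Γ (y + β⁻¹ * j)) * G y *
        (conj (K (y + α * k)) * F (y + α * k + β⁻¹ * j)) := fun k => by
      refine (integral_add_right_eq_self (fun y => conj (K y) * G (y - α * k) *
        (conj (Γ (y + β⁻¹ * j - α * k)) * F (y + β⁻¹ * j))) (α * k)).symm.trans ?_
      congr 1 with y
      rw [add_sub_cancel_right, show y + α * k + β⁻¹ * j - α * k = y + β⁻¹ * j by ring]
      ring
    simp_rw [hJ]
    rw [← this.tsum_eq]
    refine tsum_congr fun l => ?_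
    rw [latPt_neg, latPt, Prod.neg_mk, inner_tf_left_eq_integral hΓ hG,
      inner_tf_right_eq_integral hF hK, mul_mul_mul_comm, unitExp_mul_neg_self, one_mul, mul_comm]
    simp only [neg_mul, neg_neg, sub_neg_eq_add]
  simp_rw [h1, h2]
  rw [tsum_mul_left, tsum_mul_left, ← mul_assoc, ← ofReal_mul,
    show (α * β)⁻¹ * α = β⁻¹ by field_simp]
  congr 1
  obtain ⟨S, hS⟩ := exists_finset_mul_shift_eq_zero hK.compact.conj hF.compact hβ'
  obtain ⟨R, hR⟩ := exists_finset_mul_shift_eq_zero hG.compact hK.compact.conj hα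
  have hJ0 : ∀ n ∉ R ×ˢ S, J n.1 n.2 = 0 := fun n hn => by
    rw [Finset.mem_product, not_and_or] at hn
    rcases hn with hn | hn
    · have : ∀ y, conj (K y) * G (y - α * n.1) = 0 := fun y => by
        have := hR n.1 hn (y - α * n.1)
        rwa [sub_add_cancel, mul_comm] at this
      simp [J, this]
    · have : ∀ y, conj (K y) * F (y + β⁻¹ * n.2) = 0 := hS n.2 hn
      have : ∀ y, conj (K y) * G (y - α * n.1) *
          (conj (Γ (y + β⁻¹ * n.2 - α * n.1)) * F (y + β⁻¹ * n.2)) = 0 := fun y => by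
        linear_combination G (y - α * n.1) * conj (Γ (y + β⁻¹ * n.2 - α * n.1)) * this y
      simp [J, this]
  exact (Summable.tsum_comm (f := J) (summable_of_ne_finset_zero (s := R ×ˢ S) hJ0)).symm

end TestFunctions

section FundamentalIdentity

lemma IsBessel.inverse_shift {g : L2} {a b B : ℝ} (h : IsBessel (fun n => tf (latPt a b n) g) B) :
    IsBessel (fun n => tfInv (latPt a b n) g) B :=
  (h.comp_injective neg_injective).smul_unit
    (fun n => unitExp ((latPt a b n).1 * (latPt a b n).2)) (fun _ => norm_unitExp _) fun n => by
      rw [tfInv_apply, latPt_neg]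

lemma IsBessel.of_inverse_shift {g : L2} {a b B : ℝ}
    (h : IsBessel (fun n => tfInv (latPt a b n) g) B) :
    IsBessel (fun n => tf (latPt a b n) g) B :=
  (h.comp_injective neg_injective).smul_unit
    (fun n => unitExp (-((latPt a b n).1 * (latPt a b n).2))) (fun _ => norm_unitExp _) fun n => by
      rw [tfInv_apply, latPt_neg, neg_neg, smul_smul, Prod.fst_neg, Prod.snd_neg, neg_mul_neg,
        unitExp_neg_mul_self, one_smul]

lemma HasSum.inner_const {ι : Type*} {c : ι → ℂ} {v : ι → L2} {y : L2} (x : L2)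
    (h : HasSum (fun i => c i • v i) y) : HasSum (fun i => c i * ⟪x, v i⟫_ℂ) ⟪x, y⟫_ℂ := by
  simpa [Function.comp_def, inner_smul_right] using h.mapL (innerSL ℂ x)

lemma eq_of_inner_isTest {x y : L2} (h : ∀ u, IsTest u → ⟪u, x⟫_ℂ = ⟪u, y⟫_ℂ) : x = y := by
  refine ext_inner_left ℂ fun u => ?_
  have : (fun u : L2 => ⟪u, x⟫_ℂ) = fun u => ⟪u, y⟫_ℂ :=
    Continuous.ext_on dense_isTest (by fun_prop) (by fun_prop) h
  exact congrFun this u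

/-- The fundamental identity of Gabor analysis for two arbitrary and two test functions. -/
lemma tsum_inner_eq {α β : ℝ} (hα : 0 < α) (hβ : 0 < β) {f h : L2}
    (hf : IsTest f) (hh : IsTest h) (g γ : L2) :
    ∑' n, ⟪tf (latPt α β n) γ, f⟫_ℂ * ⟪h, tf (latPt α β n) g⟫_ℂ =
      ((α * β)⁻¹ : ℝ) * ∑' n, ⟪tf (latPt β⁻¹ α⁻¹ n) γ, g⟫_ℂ * ⟪h, tf (latPt β⁻¹ α⁻¹ n) f⟫_ℂ := by
  obtain ⟨B, hB⟩ := hf.exists_isBessel hα hβ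
  obtain ⟨C, hC⟩ := hh.exists_isBessel hα hβ
  obtain ⟨K, hK⟩ := IsBessel.exists_frameOp hB.inverse_shift hC.inverse_shift
  have hsum : Summable fun n =>
      ⟪h, tf (latPt β⁻¹ α⁻¹ n) f⟫_ℂ • tfInv (latPt β⁻¹ α⁻¹ n) := by
    refine Summable.of_norm_bounded
      (hf.summable_inner hh (inv_pos.2 hβ) (inv_pos.2 hα)) fun n => ?_
    rw [norm_smul]
    refine mul_le_of_le_one_right (norm_nonneg _) ?_
    exact ContinuousLinearMap.opNorm_le_bound _ zero_le_one fun u => by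
      rw [norm_tfInv, one_mul]
  obtain ⟨R, hR⟩ := hsum
  have hKi : ∀ g γ, ∑' n, ⟪tf (latPt α β n) γ, f⟫_ℂ * ⟪h, tf (latPt α β n) g⟫_ℂ = ⟪γ, K g⟫_ℂ :=
    fun g γ => by
      rw [← ((hK g).inner_const γ).tsum_eq]
      refine tsum_congr fun n => ?_
      rw [inner_tf_left, inner_tf_right, mul_comm]
  have hRi : ∀ g γ, ∑' n, ⟪tf (latPt β⁻¹ α⁻¹ n) γ, g⟫_ℂ * ⟪h, tf (latPt β⁻¹ α⁻¹ n) f⟫_ℂ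
      = ⟪γ, R g⟫_ℂ := fun g γ => by
    have := hR.mapL (ContinuousLinearMap.apply ℂ L2 g)
    simp only [ContinuousLinearMap.apply_apply, smul_apply] at this
    rw [← (this.inner_const γ).tsum_eq]
    refine tsum_congr fun n => ?_
    rw [inner_tf_left, mul_comm]
  have hKR : (fun g => K g) = fun g => (((α * β)⁻¹ : ℝ) : ℂ) • R g := by
    refine Continuous.ext_on dense_isTest (by fun_prop) (by fun_prop) fun g hg => ?_
    refine eq_of_inner_isTest fun γ hγ => ?_
    rw [inner_smul_right, ← hKi, ← hRi]
    exact tsum_inner_eq_of_isTest hα hβ hf hh hg hγ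
  rw [hKi, hRi, ← inner_smul_right]
  exact congrArg (fun x => ⟪γ, x⟫_ℂ) (congrFun hKR g)

/-- Janssen's representation of a mixed frame operator. -/
lemma hasSum_janssen {α β : ℝ} (hα : 0 < α) (hβ : 0 < β) {g γ f : L2} {A B : ℝ}
    (hg : IsBessel (fun n => tf (latPt β⁻¹ α⁻¹ n) g) A)
    (hf : IsBessel (fun n => tf (latPt β⁻¹ α⁻¹ n) f) B) {S : L2 →L[ℂ] L2}
    (hS : ∀ u, HasSum (fun n => ⟪tf (latPt α β n) γ, u⟫_ℂ • tf (latPt α β n) g) (S u)) :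
    HasSum (fun n => ((((α * β)⁻¹ : ℝ) : ℂ) * ⟪tf (latPt β⁻¹ α⁻¹ n) γ, g⟫_ℂ) •
      tf (latPt β⁻¹ α⁻¹ n) f) (S f) := by
  have hc : Summable fun n => ‖⟪tf (latPt β⁻¹ α⁻¹ n) γ, g⟫_ℂ‖ ^ 2 :=
    (hg.inverse_shift.summable_sq γ).congr fun n => by rw [inner_tf_left, norm_inner_symm]
  obtain ⟨y, hy⟩ := hf.summable_smul hc
  have key : S f = (((α * β)⁻¹ : ℝ) : ℂ) • y := by
    refine eq_of_inner_isTest fun h hh => ?_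
    obtain ⟨C, hC⟩ := hh.exists_isBessel (inv_pos.2 hβ) (inv_pos.2 hα)
    obtain ⟨x, hx⟩ := hC.inverse_shift.summable_smul
      (c := fun n => conj ⟪tf (latPt β⁻¹ α⁻¹ n) γ, g⟫_ℂ)
      (by simpa only [RCLike.norm_conj] using hc)
    have hxi : ∀ u, HasSum (fun n => ⟪tf (latPt β⁻¹ α⁻¹ n) γ, g⟫_ℂ *
        ⟪h, tf (latPt β⁻¹ α⁻¹ n) u⟫_ℂ) ⟪x, u⟫_ℂ := fun u => by
      have := (hx.inner_const u).map (starRingEnd ℂ) Complex.continuous_conj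
      rw [inner_conj_symm] at this
      refine this.congr_fun fun n => ?_
      rw [Function.comp_apply, map_mul, Complex.conj_conj, inner_conj_symm, ← inner_tf_right]
    have hE : (fun u => ⟪h, S u⟫_ℂ) = fun u => (((α * β)⁻¹ : ℝ) : ℂ) * ⟪x, u⟫_ℂ := by
      refine Continuous.ext_on dense_isTest (by fun_prop) (by fun_prop) fun u hu => ?_
      rw [← (hxi u).tsum_eq, ← ((hS u).inner_const h).tsum_eq]
      exact tsum_inner_eq hα hβ hu hh g γ
    rw [inner_smul_right, (hy.inner_const h).unique (hxi f)]
    exact congrFun hE f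
  rw [key]
  simpa only [smul_smul] using hy.const_smul (((α * β)⁻¹ : ℝ) : ℂ)

end FundamentalIdentity

section Duality

/-- The character `p ↦ e^{2πi(n₂p₁ - n₁p₂)}` of the plane. -/
def planeChar (n : ℤ × ℤ) (p : ℝ × ℝ) : ℂ := unitExp (n.2 * p.1 - n.1 * p.2)

/-- The uniform probability measure on the unit square. -/
def unitSquare : Measure (ℝ × ℝ) :=
  (volume.restrict (Set.Ioc (0 : ℝ) 1)).prod (volume.restrict (Set.Ioc (0 : ℝ) 1))

instance : IsFiniteMeasure unitSquare := by unfold unitSquare; infer_instance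

lemma norm_planeChar (n : ℤ × ℤ) (p : ℝ × ℝ) : ‖planeChar n p‖ = 1 := norm_unitExp _

lemma continuous_planeChar (n : ℤ × ℤ) : Continuous (planeChar n) :=
  continuous_unitExp.comp (by fun_prop)

lemma planeChar_add_sub (n j i : ℤ × ℤ) (p : ℝ × ℝ) :
    planeChar (n + j - i) p = conj (planeChar i p) * (planeChar n p * planeChar j p) := by
  simp only [planeChar, conj_unitExp, ← unitExp_add]
  congr 1
  push_cast [Prod.fst_sub, Prod.snd_sub, Prod.fst_add, Prod.snd_add]
  ring

lemma integral_unitExp_int (m : ℤ) :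
    ∫ x in Set.Ioc (0 : ℝ) 1, unitExp (m * x) = if m = 0 then 1 else 0 := by
  split_ifs with hm
  · simp [hm, unitExp_zero]
  · have h0 : 2 * Real.pi * Complex.I * m ≠ 0 := by
      simp [Real.pi_ne_zero, hm]
    have h1 : ∀ x : ℝ, unitExp (m * x) = Complex.exp (2 * Real.pi * Complex.I * m * x) := by
      intro x
      simp only [unitExp]
      push_cast
      ring_nf
    rw [← intervalIntegral.integral_of_le zero_le_one]
    simp only [h1]
    rw [integral_exp_mul_complex h0, ← h1 1, ← h1 0]
    simp [unitExp_intCast, unitExp_zero]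

lemma integral_planeChar (n : ℤ × ℤ) :
    ∫ p, planeChar n p ∂unitSquare = if n = 0 then 1 else 0 := by
  have h : ∀ p, planeChar n p = unitExp (n.2 * p.1) * unitExp ((-n.1 : ℤ) * p.2) := fun p => by
    rw [planeChar, ← unitExp_add]
    congr 1
    push_cast
    ring
  simp only [h, unitSquare]
  rw [integral_prod_mul (fun x : ℝ => unitExp (n.2 * x)) (fun x : ℝ => unitExp ((-n.1 : ℤ) * x)),
    integral_unitExp_int, integral_unitExp_int]
  obtain ⟨a, b⟩ := n
  by_cases ha : a = 0 <;> by_cases hb : b = 0 <;> simp [ha, hb]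

lemma integrable_planeChar (n : ℤ × ℤ) : Integrable (planeChar n) unitSquare :=
  .of_bound (continuous_planeChar n).aestronglyMeasurable 1
    (Eventually.of_forall fun p => (norm_planeChar n p).le)

variable {α β : ℝ}

lemma tf_adjoint_comm (hα : α ≠ 0) (hβ : β ≠ 0) (n : ℤ × ℤ) (p : ℝ × ℝ) (f : L2) :
    tf (latPt β⁻¹ α⁻¹ n) (tf (α * p.1, β * p.2) f) =
      planeChar n p • tf (α * p.1, β * p.2) (tf (latPt β⁻¹ α⁻¹ n) f) := by
  rw [tf_comm, planeChar]
  congr 2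
  simp only [latPt]
  field_simp

lemma inner_adjoint_shift (hα : α ≠ 0) (hβ : β ≠ 0) (i n j : ℤ × ℤ) (p : ℝ × ℝ) (f : L2) :
    ⟪tf (latPt β⁻¹ α⁻¹ i) (tf (α * p.1, β * p.2) f),
      tf (latPt β⁻¹ α⁻¹ n) (tf (latPt β⁻¹ α⁻¹ j) (tf (α * p.1, β * p.2) f))⟫_ℂ =
    planeChar (n + j - i) p *
      ⟪tf (latPt β⁻¹ α⁻¹ i) f, tf (latPt β⁻¹ α⁻¹ n) (tf (latPt β⁻¹ α⁻¹ j) f)⟫_ℂ := by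
  rw [tf_adjoint_comm hα hβ i, tf_adjoint_comm hα hβ j, tf_smul, tf_adjoint_comm hα hβ n,
    smul_smul, inner_smul_left, inner_smul_right, inner_tf_tf, planeChar_add_sub]
  ring

lemma inner_adjoint_diff (a b : ℝ) (i j : ℤ × ℤ) (f g : L2) :
    ⟪tf (latPt a b (i - j)) g, g⟫_ℂ *
        ⟪tf (latPt a b i) f, tf (latPt a b (i - j)) (tf (latPt a b j) f)⟫_ℂ =
      ((‖f‖ ^ 2 : ℝ) : ℂ) * ⟪tfInv (latPt a b j) g, tfInv (latPt a b i) g⟫_ℂ := by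
  obtain ⟨t, ht⟩ : ∃ t : ℝ, ∀ u, tf (latPt a b (i - j)) (tf (latPt a b j) u) =
      unitExp t • tf (latPt a b i) u :=
    ⟨_, fun u => by rw [tf_tf, ← latPt_add, sub_add_cancel]⟩
  have h := ht (tfInv (latPt a b j) g)
  rw [tf_tfInv] at h
  rw [h, ht, inner_smul_left, inner_smul_right, inner_tf_tf, inner_tf_left,
    inner_self_eq_norm_sq_to_K, conj_unitExp]
  push_cast
  linear_combination ((‖f‖ : ℂ) ^ 2 * ⟪tfInv (latPt a b j) g, tfInv (latPt a b i) g⟫_ℂ) *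
    unitExp_mul_neg_self t

/-- The averaged form of the fundamental identity. -/
lemma IsBessel.norm_sum_adjoint_sq_le (hα : 0 < α) (hβ : 0 < β) {g f : L2} {B : ℝ}
    (hB : IsBessel (fun n => tf (latPt α β n) g) B) (hf : IsTest f) (s : Finset (ℤ × ℤ))
    (e : ℤ × ℤ → ℂ) :
    ‖f‖ ^ 2 * ‖∑ i ∈ s, conj (e i) • tfInv (latPt β⁻¹ α⁻¹ i) g‖ ^ 2 ≤
      α * β * B * (‖f‖ ^ 2 * ∑ i ∈ s, ‖e i‖ ^ 2) := by
  set W : ℤ × ℤ → L2 → L2 := fun n => tf (latPt β⁻¹ α⁻¹ n) with hW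
  set c : ℤ × ℤ → ℂ := fun n => ⟪W n g, g⟫_ℂ with hc
  set F : ℝ × ℝ → L2 := fun p => ∑ i ∈ s, e i • W i (tf (α * p.1, β * p.2) f) with hF
  set Q : ℤ × ℤ → ℝ × ℝ → ℂ := fun n p => ⟪F p, W n (F p)⟫_ℂ with hQ
  have hW0 : ∀ u, W 0 u = u := fun u => by
    simp only [hW]
    rw [show latPt β⁻¹ α⁻¹ 0 = 0 by simp [latPt], tf_zero]
  have hFtest : ∀ p, IsTest (F p) := fun p =>
    .sum s fun i => ((hf.shift _).shift _).smul _
  have hQeq : ∀ n p, Q n p = ∑ i ∈ s, ∑ j ∈ s, conj (e i) * e j * ⟪W i f, W n (W j f)⟫_ℂ *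
      planeChar (n + j - i) p := fun n p => by
    simp only [hQ, hF, hW]
    rw [sum_inner]
    refine Finset.sum_congr rfl fun i _ => ?_
    rw [tf_sum, inner_sum]
    refine Finset.sum_congr rfl fun j _ => ?_
    rw [tf_smul, inner_smul_left, inner_smul_right, inner_adjoint_shift hα.ne' hβ.ne']
    ring
  set b : ℤ × ℤ → ℝ := fun n => ∑ i ∈ s, ∑ j ∈ s, ‖e i‖ * ‖e j‖ * ‖⟪W i f, W n (W j f)⟫_ℂ‖ with hb
  have hbsum : Summable b := summable_sum fun i _ => summable_sum fun j _ =>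
    ((hf.shift _).summable_inner (hf.shift _) (inv_pos.2 hβ) (inv_pos.2 hα)).mul_left _
  have hQb : ∀ n p, ‖Q n p‖ ≤ b n := fun n p => by
    rw [hQeq]
    refine (norm_sum_le _ _).trans (Finset.sum_le_sum fun i _ => (norm_sum_le _ _).trans_eq
      (Finset.sum_congr rfl fun j _ => ?_))
    rw [norm_mul, norm_planeChar, mul_one, norm_mul, norm_mul, RCLike.norm_conj]
  have hQcont : ∀ n, Continuous (Q n) := fun n => by
    have : Q n = _ := funext (hQeq n)
    rw [this]
    exact continuous_finsetSum _ fun i _ => continuous_finsetSum _ fun j _ =>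
      continuous_const.mul (continuous_planeChar _)
  have hcb : ∀ n, ‖c n‖ ≤ ‖g‖ ^ 2 := fun n => by
    refine (norm_inner_le_norm _ _).trans_eq ?_
    rw [hW, norm_tf, sq]
  have hcQb : ∀ n p, ‖c n * Q n p‖ ≤ ‖g‖ ^ 2 * b n := fun n p => by
    rw [norm_mul]
    exact mul_le_mul (hcb n) (hQb n p) (norm_nonneg _) (by positivity)
  have hQint : ∀ n, ∫ p, Q n p ∂unitSquare = ∑ i ∈ s, ∑ j ∈ s,
      conj (e i) * e j * ⟪W i f, W n (W j f)⟫_ℂ * if n + j - i = 0 then 1 else 0 := fun n => by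
    simp only [hQeq]
    rw [integral_finsetSum _ fun i _ => integrable_finsetSum _ fun j _ =>
      (integrable_planeChar _).const_mul _]
    refine Finset.sum_congr rfl fun i _ => ?_
    rw [integral_finsetSum _ fun j _ => (integrable_planeChar _).const_mul _]
    refine Finset.sum_congr rfl fun j _ => ?_
    rw [integral_const_mul, integral_planeChar]
  have hcQcont : Continuous fun p => ∑' n, c n * Q n p :=
    continuous_tsum (fun n => continuous_const.mul (hQcont n)) (hbsum.mul_left _) hcQb
  have hcQint : Integrable (fun p => ∑' n, c n * Q n p) unitSquare :=
    .of_bound hcQcont.aestronglyMeasurable (∑' n, ‖g‖ ^ 2 * b n)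
      (Eventually.of_forall fun p => tsum_of_norm_bounded (hbsum.mul_left _).hasSum (hcQb · p))
  have hQ0int : Integrable (Q 0) unitSquare :=
    .of_bound (hQcont 0).aestronglyMeasurable (b 0) (Eventually.of_forall (hQb 0))
  have hpoint : ∀ p, (∑' n, c n * Q n p).re ≤ α * β * B * (Q 0 p).re := fun p => by
    have h1 := tsum_inner_eq hα hβ (hFtest p) (hFtest p) g g
    have h2 : ∑' n, ⟪tf (latPt α β n) g, F p⟫_ℂ * ⟪F p, tf (latPt α β n) g⟫_ℂ =
        ((∑' n, ‖⟪tf (latPt α β n) g, F p⟫_ℂ‖ ^ 2 : ℝ) : ℂ) := by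
      rw [Complex.ofReal_tsum]
      refine tsum_congr fun n => ?_
      rw [← inner_conj_symm (F p), Complex.mul_conj']
      push_cast
      rfl
    have h3 : ∑' n, ‖⟪tf (latPt α β n) g, F p⟫_ℂ‖ ^ 2 ≤ B * ‖F p‖ ^ 2 :=
      (hB.summable_sq _).tsum_le_of_sum_le fun t => hB.bound t _
    have h4 : (Q 0 p).re = ‖F p‖ ^ 2 := by
      simp only [hQ, hW0]
      exact inner_self_eq_norm_sq (𝕜 := ℂ) (F p)
    have h5 := congrArg Complex.re (h2.symm.trans h1)
    rw [Complex.ofReal_re, Complex.re_ofReal_mul] at h5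
    rw [h4, mul_assoc]
    have h6 : 0 < α * β := by positivity
    rw [h5, inv_mul_le_iff₀ h6] at h3
    exact h3
  have hmono := integral_mono hcQint.re (hQ0int.re.const_mul (α * β * B)) hpoint
  have hre : ∀ {φ : ℝ × ℝ → ℂ}, Integrable φ unitSquare →
    ∫ p, RCLike.re (φ p) ∂unitSquare = (∫ p, φ p ∂unitSquare).re := fun h => integral_re h
  rw [integral_const_mul, hre hcQint, hre hQ0int, hQint] at hmono
  have hswap : ∫ p, ∑' n, c n * Q n p ∂unitSquare =
      ((‖f‖ ^ 2 * ‖∑ i ∈ s, conj (e i) • tfInv (latPt β⁻¹ α⁻¹ i) g‖ ^ 2 : ℝ) : ℂ) := by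
    have h1 := hasSum_integral_of_summable_integral_norm (μ := unitSquare)
      (F := fun n p => c n * Q n p)
      (fun n => .of_bound (continuous_const.mul (hQcont n)).aestronglyMeasurable _
        (Eventually.of_forall (hcQb n)))
      (((hbsum.mul_left (‖g‖ ^ 2)).mul_left (unitSquare.real Set.univ)).of_nonneg_of_le
        (fun n => integral_nonneg fun p => norm_nonneg _) fun n => by
          refine (integral_mono_of_nonneg (Eventually.of_forall fun p => norm_nonneg _)
            (integrable_const (‖g‖ ^ 2 * b n)) (Eventually.of_forall (hcQb n))).trans_eq ?_
          rw [integral_const, smul_eq_mul])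
    have h2 : HasSum (fun n => ∫ p, c n * Q n p ∂unitSquare) (∑ i ∈ s, ∑ j ∈ s,
        conj (e i) * e j * (((‖f‖ ^ 2 : ℝ) : ℂ) *
          ⟪tfInv (latPt β⁻¹ α⁻¹ j) g, tfInv (latPt β⁻¹ α⁻¹ i) g⟫_ℂ)) := by
      simp only [integral_const_mul, hQint, Finset.mul_sum]
      refine hasSum_sum fun i _ => hasSum_sum fun j _ => ?_
      convert hasSum_single (i - j) fun n hn => ?_ using 1
      · rw [← inner_adjoint_diff, sub_add_cancel, sub_self, if_pos rfl]
        simp only [hc, hW]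
        ring
      · rw [if_neg fun h0 => hn ?_, mul_zero, mul_zero]
        rw [← sub_eq_zero, ← h0]
        abel
    rw [h1.unique h2]
    push_cast
    have h3 : ∀ v : L2, (‖v‖ : ℂ) ^ 2 = ⟪v, v⟫_ℂ := fun v =>
      (inner_self_eq_norm_sq_to_K (𝕜 := ℂ) v).symm
    rw [h3 (∑ i ∈ s, _), inner_sum, Finset.mul_sum]
    refine Finset.sum_congr rfl fun i _ => ?_
    rw [sum_inner, Finset.mul_sum]
    refine Finset.sum_congr rfl fun j _ => ?_
    rw [inner_smul_left, inner_smul_right, Complex.conj_conj]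
    ring
  have hdiag : ∑ i ∈ s, ∑ j ∈ s, conj (e i) * e j * ⟪W i f, W 0 (W j f)⟫_ℂ *
      (if 0 + j - i = 0 then 1 else 0) = ((‖f‖ ^ 2 * ∑ i ∈ s, ‖e i‖ ^ 2 : ℝ) : ℂ) := by
    push_cast
    rw [Finset.mul_sum]
    refine Finset.sum_congr rfl fun i hi => ?_
    rw [Finset.sum_eq_single_of_mem i hi fun j _ hj => by
      rw [zero_add, if_neg (sub_ne_zero.2 hj), mul_zero]]
    rw [hW0, zero_add, sub_self, if_pos rfl, mul_one, Complex.conj_mul', hW, inner_tf_tf,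
      inner_self_eq_norm_sq_to_K, mul_comm]
    rfl
  rw [hswap, hdiag, Complex.ofReal_re, Complex.ofReal_re] at hmono
  exact hmono

/-- The Bessel property passes to the adjoint lattice. -/
lemma IsBessel.exists_adjoint (hα : 0 < α) (hβ : 0 < β) {g : L2} {B : ℝ}
    (hB : IsBessel (fun n => tf (latPt α β n) g) B) :
    ∃ C, IsBessel (fun n => tf (latPt β⁻¹ α⁻¹ n) g) C := by
  by_cases h : ∃ f : L2, IsTest f ∧ f ≠ 0
  · obtain ⟨f, hf, hf0⟩ := h
    refine ⟨α * β * B, .of_inverse_shift (.of_norm_sum_sq_le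
      (mul_nonneg (by positivity) hB.nonneg) fun s e => ?_)⟩
    have h1 := hB.norm_sum_adjoint_sq_le hα hβ hf s fun i => conj (e i)
    simp only [Complex.conj_conj, RCLike.norm_conj] at h1
    rw [mul_left_comm] at h1
    exact le_of_mul_le_mul_left h1 (by positivity)
  · push Not at h
    have : g = 0 := eq_of_inner_isTest fun u hu => by rw [h u hu, inner_zero_left, inner_zero_left]
    subst this
    exact isTest_zero.exists_isBessel (inv_pos.2 hβ) (inv_pos.2 hα)

end Duality

section FrameSequence

variable {H : Type*} [NormedAddCommGroup H] [InnerProductSpace ℂ H] {ι : Type*}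

/-- A family in a closed subspace that is Bessel on this subspace is Bessel. -/
lemma IsBessel.of_subspace {v : ι → H} {K : Submodule ℂ H} [K.HasOrthogonalProjection] {B : ℝ}
    (hB : 0 ≤ B) (hv : ∀ i, v i ∈ K)
    (h : ∀ (s : Finset ι), ∀ u ∈ K, ∑ i ∈ s, ‖⟪v i, u⟫_ℂ‖ ^ 2 ≤ B * ‖u‖ ^ 2) : IsBessel v B := by
  refine ⟨hB, fun s u => ?_⟩
  have h1 : ∀ i, ⟪v i, u⟫_ℂ = ⟪v i, K.starProjection u⟫_ℂ := fun i => by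
    rw [← Submodule.inner_starProjection_left_eq_right,
      Submodule.starProjection_eq_self_iff.2 (hv i)]
  simp only [h1]
  refine (h s _ (K.starProjection_apply_mem u)).trans ?_
  gcongr
  exact K.norm_starProjection_apply_le u

lemma IsBessel.of_frame {v : ι → H} {K : Submodule ℂ H} [K.HasOrthogonalProjection] {A B : ℝ}
    (hA : 0 < A) (hB : 0 ≤ B) (hv : ∀ i, v i ∈ K)
    (h : ∀ f ∈ K, A * ‖f‖ ^ 2 ≤ ∑' i, ‖⟪v i, f⟫_ℂ‖ ^ 2 ∧ ∑' i, ‖⟪v i, f⟫_ℂ‖ ^ 2 ≤ B * ‖f‖ ^ 2) :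
    IsBessel v B := by
  refine .of_subspace hB hv fun s u hu => ?_
  have hs : Summable fun i => ‖⟪v i, u⟫_ℂ‖ ^ 2 := by
    by_contra hn
    have h1 := (h u hu).1
    rw [tsum_eq_zero_of_not_summable hn] at h1
    have h2 : u = 0 := by
      by_contra h0
      have : 0 < A * ‖u‖ ^ 2 := by positivity
      linarith
    exact hn (by simp [h2])
  exact (hs.sum_le_tsum s fun _ _ => by positivity).trans (h u hu).2

/-- A canonical dual family of a frame for a closed span is Bessel and reproduces this span. -/
lemma IsBessel.dual [CompleteSpace H] {v w : ι → H} {A B : ℝ} (hA : 0 < A) (hv : IsBessel v B)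
    (hw : ∀ i, w i ∈ (Submodule.span ℂ (Set.range v)).topologicalClosure)
    (hlow : ∀ f ∈ (Submodule.span ℂ (Set.range v)).topologicalClosure,
      A * ‖f‖ ^ 2 ≤ ∑' i, ‖⟪v i, f⟫_ℂ‖ ^ 2)
    (hdual : ∀ i, HasSum (fun j => ⟪v j, w i⟫_ℂ • v j) (v i)) :
    (∃ C, IsBessel w C) ∧ ∀ R : H →L[ℂ] H, (∀ f, HasSum (fun i => ⟪w i, f⟫_ℂ • v i) (R f)) →
      ∀ f ∈ (Submodule.span ℂ (Set.range v)).topologicalClosure, R f = f := by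
  set K := (Submodule.span ℂ (Set.range v)).topologicalClosure with hK
  have : CompleteSpace K := (Submodule.isClosed_topologicalClosure _).completeSpace_coe
  obtain ⟨S, hS⟩ := IsBessel.exists_frameOp hv hv
  have hinner : ∀ x y, HasSum (fun i => ⟪v i, y⟫_ℂ * ⟪x, v i⟫_ℂ) ⟪x, S y⟫_ℂ := fun x y => by
    simpa [Function.comp_def, inner_smul_right] using (hS y).mapL (innerSL ℂ x)
  have hsymm : ∀ x y, ⟪x, S y⟫_ℂ = ⟪S x, y⟫_ℂ := fun x y => by
    rw [← inner_conj_symm (S x)]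
    refine (hinner x y).unique ?_
    have := (hinner y x).map (starRingEnd ℂ) Complex.continuous_conj
    refine this.congr_fun fun i => ?_
    rw [Function.comp_apply, map_mul, inner_conj_symm, inner_conj_symm, mul_comm]
  have hSw : ∀ i, S (w i) = v i := fun i => (hS _).unique (hdual i)
  have hpre : ∀ f ∈ Submodule.span ℂ (Set.range v), ∃ x ∈ K, S x = f := by
    intro f hf
    have : Submodule.span ℂ (Set.range v) ≤ K.map S.toLinearMap := by
      rw [Submodule.span_le]
      rintro _ ⟨i, rfl⟩
      exact ⟨w i, hw i, hSw i⟩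
    exact this hf
  have hcoef : ∀ i x, ⟪w i, S x⟫_ℂ = ⟪v i, x⟫_ℂ := fun i x => by rw [hsymm, hSw]
  have hlow' : ∀ x ∈ K, A * ‖x‖ ≤ ‖S x‖ := fun x hx => by
    have h1 : HasSum (fun i => ‖⟪v i, x⟫_ℂ‖ ^ 2) (⟪x, S x⟫_ℂ).re := by
      refine (Complex.hasSum_re (hinner x x)).congr_fun fun i => ?_
      rw [← inner_conj_symm x, Complex.mul_conj', ← Complex.ofReal_pow, Complex.ofReal_re]
    have h2 := hlow x hx
    rw [h1.tsum_eq] at h2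
    have h3 : (⟪x, S x⟫_ℂ).re ≤ ‖x‖ * ‖S x‖ :=
      (Complex.re_le_norm _).trans (norm_inner_le_norm _ _)
    rcases (norm_nonneg x).eq_or_lt with h0 | h0
    · rw [← h0, mul_zero]; exact norm_nonneg _
    · refine le_of_mul_le_mul_left ?_ h0
      nlinarith
  refine ⟨⟨B * (A⁻¹) ^ 2, .of_subspace (K := K) (mul_nonneg hv.nonneg (by positivity)) hw
    fun s u hu => ?_⟩, fun R hR f hf => ?_⟩
  · have hcl : IsClosed {u : H | ∑ i ∈ s, ‖⟪w i, u⟫_ℂ‖ ^ 2 ≤ B * (A⁻¹) ^ 2 * ‖u‖ ^ 2} :=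
      isClosed_le (by fun_prop) (by fun_prop)
    refine closure_minimal (fun f hf => ?_) hcl hu
    obtain ⟨x, hx, rfl⟩ := hpre f hf
    simp only [Set.mem_ofPred_eq, hcoef]
    refine (hv.bound s x).trans ?_
    rw [mul_assoc, ← mul_pow]
    have h1 : ‖x‖ ≤ A⁻¹ * ‖S x‖ := (le_inv_mul_iff₀ hA).2 (hlow' x hx)
    have := hv.nonneg
    gcongr
  · have hcl : IsClosed {u : H | R u = u} := isClosed_eq (by fun_prop) (by fun_prop)
    refine closure_minimal (fun f hf => ?_) hcl hf
    obtain ⟨x, hx, rfl⟩ := hpre f hf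
    have := hR (S x)
    simp only [hcoef] at this
    exact this.unique (hS x)

end FrameSequence

section Lattice

/-- The parametrisation of `αℤ × βℤ` by `ℤ × ℤ`. -/
def latEquiv {α β : ℝ} (hα : 0 < α) (hβ : 0 < β) : ℤ × ℤ ≃ sepLattice α β :=
  Equiv.ofBijective (fun n => ⟨latPt α β n, n.1, n.2, rfl⟩) <| by
    constructor
    · intro m n h
      have h' : latPt α β m = latPt α β n := congrArg Subtype.val h
      simp only [latPt, Prod.mk.injEq, mul_eq_mul_left_iff, hα.ne', hβ.ne', or_false,
        Int.cast_inj] at h'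
      exact Prod.ext h'.1 h'.2
    · rintro ⟨_, k, l, rfl⟩
      exact ⟨(k, l), rfl⟩

@[simp] lemma coe_latEquiv {α β : ℝ} (hα : 0 < α) (hβ : 0 < β) (n : ℤ × ℤ) :
    (latEquiv hα hβ n : ℝ × ℝ) = latPt α β n := rfl

/-- The closed linear span of a Gabor system over `αℤ × βℤ` as a submodule. -/
def gaborModule (g : L2) (α β : ℝ) : Submodule ℂ L2 :=
  (Submodule.span ℂ (Set.range fun n => tf (latPt α β n) g)).topologicalClosure

lemma mem_gaborSpan_iff {g f : L2} {α β : ℝ} :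
    f ∈ gaborSpan g (sepLattice α β) ↔ f ∈ gaborModule g α β := by
  have : (fun z => tf z g) '' sepLattice α β = Set.range fun n => tf (latPt α β n) g := by
    ext x
    constructor
    · rintro ⟨_, ⟨k, l, rfl⟩, rfl⟩
      exact ⟨(k, l), rfl⟩
    · rintro ⟨n, rfl⟩
      exact ⟨_, ⟨n.1, n.2, rfl⟩, rfl⟩
  rw [gaborSpan, this]
  rfl

lemma tf_latPt_mem_gaborModule (g : L2) (α β : ℝ) (n : ℤ × ℤ) :
    tf (latPt α β n) g ∈ gaborModule g α β :=
  Submodule.le_topologicalClosure _ (Submodule.subset_span ⟨n, rfl⟩)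

lemma tf_mem_gaborModule_of_forall {g : L2} {α β : ℝ} {z : ℝ × ℝ}
    (h : ∀ n, tf z (tf (latPt α β n) g) ∈ gaborModule g α β) {f : L2}
    (hf : f ∈ gaborModule g α β) : tf z f ∈ gaborModule g α β := by
  have h1 : gaborModule g α β ≤ (gaborModule g α β).comap (tfL z).toLinearMap := by
    refine Submodule.topologicalClosure_minimal _ ?_ ?_
    · rw [Submodule.span_le]
      rintro _ ⟨n, rfl⟩
      exact h n
    · exact (Submodule.isClosed_topologicalClosure _).preimage (tfL z).continuous
  exact h1 hf

lemma tf_latPt_mem {g f : L2} {α β : ℝ} (hf : f ∈ gaborModule g α β) (k : ℤ × ℤ) :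
    tf (latPt α β k) f ∈ gaborModule g α β :=
  tf_mem_gaborModule_of_forall (fun n => by
    rw [tf_tf, ← latPt_add]
    exact Submodule.smul_mem _ _ (tf_latPt_mem_gaborModule g α β _)) hf

/-- A time-frequency shift mapping the window into `𝒢` leaves `𝒢` invariant. -/
lemma tf_mem_gaborModule {g f : L2} {α β : ℝ} {z : ℝ × ℝ} (hz : tf z g ∈ gaborModule g α β)
    (hf : f ∈ gaborModule g α β) : tf z f ∈ gaborModule g α β :=
  tf_mem_gaborModule_of_forall (fun n => by
    rw [tf_comm]
    exact Submodule.smul_mem _ _ (tf_latPt_mem hz n)) hf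

/-- The frame operator commutes with the time-frequency shifts of the lattice. -/
lemma hasSum_dual_shift {g γ : L2} {α β : ℝ}
    (h : HasSum (fun n => ⟪tf (latPt α β n) g, γ⟫_ℂ • tf (latPt α β n) g) g) (k : ℤ × ℤ) :
    HasSum (fun n => ⟪tf (latPt α β n) g, tf (latPt α β k) γ⟫_ℂ • tf (latPt α β n) g)
      (tf (latPt α β k) g) := by
  rw [← (Equiv.addLeft k).hasSum_iff]
  have := h.mapL (tfL (latPt α β k))
  refine this.congr_fun fun n => ?_
  simp only [Function.comp_apply, Equiv.coe_addLeft, tfL_apply]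
  rw [tf_smul, ← inner_tf_tf (latPt α β k) _ γ, tf_tf, ← latPt_add, inner_smul_left, smul_smul,
    conj_unitExp, mul_right_comm, unitExp_neg_mul_self, one_mul]

lemma IsBessel.shift {g : L2} {a b B : ℝ} (h : IsBessel (fun n => tf (latPt a b n) g) B)
    (z : ℝ × ℝ) : IsBessel (fun n => tf (latPt a b n) (tf z g)) B :=
  (h.map_isometry (tfL z) (norm_tf z)).smul_unit _ (fun _ => norm_unitExp _) fun _ =>
    tf_comm _ _ _

end Lattice

section Main

lemma sum_unitExp_range {ν : ℕ} (hν : ν ≠ 0) (m : ℤ) :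
    ∑ r ∈ Finset.range ν, unitExp (m * r / ν) = if (ν : ℤ) ∣ m then (ν : ℂ) else 0 := by
  have hν' : (ν : ℝ) ≠ 0 := Nat.cast_ne_zero.2 hν
  have hpow : ∀ r : ℕ, unitExp (m * r / ν) = unitExp (m / ν) ^ r := fun r => by
    rw [unitExp, unitExp, ← Complex.exp_nat_mul]
    congr 1
    push_cast
    ring
  simp only [hpow]
  split_ifs with h
  · obtain ⟨d, rfl⟩ := h
    have : unitExp (((ν * d : ℤ) : ℝ) / ν) = 1 := by
      rw [← unitExp_intCast d]
      congr 1
      push_cast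
      field_simp
    simp only [this, one_pow, Finset.sum_const, Finset.card_range, nsmul_eq_mul, mul_one]
  · have h1 : unitExp (m / ν) ≠ 1 := fun h1 => h <| by
      rw [unitExp, Complex.exp_eq_one_iff] at h1
      obtain ⟨d, hd⟩ := h1
      refine ⟨d, ?_⟩
      have h2 : ((m / ν : ℝ) : ℂ) = d :=
        mul_left_cancel₀ Complex.two_pi_I_ne_zero (hd.trans (mul_comm _ _))
      have h3 : (m / ν : ℝ) = d := by exact_mod_cast h2
      rw [div_eq_iff hν'] at h3
      rw [mul_comm]
      exact_mod_cast h3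
    have h2 : unitExp (m / ν) ^ ν = 1 := by
      rw [← hpow, mul_div_assoc, div_self hν', mul_one, unitExp_intCast]
    have h3 := mul_neg_geom_sum (unitExp (m / ν)) ν
    rw [h2, sub_self] at h3
    exact (mul_eq_zero.1 h3).resolve_left (sub_ne_zero.2 h1.symm)

/-- Averaging over the `ν` translates of a Janssen representation keeps every `ν`-th frequency. -/
lemma hasSum_frequency_class {H : Type*} [NormedAddCommGroup H] [NormedSpace ℂ H] {ν : ℕ}
    (hν : ν ≠ 0) {x : ℤ × ℤ → H} {g : H}
    (h : ∀ r : ℕ, HasSum (fun n : ℤ × ℤ => unitExp (n.2 * r / ν) • x n) g) {s : ℕ} (hs : s < ν) :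
    HasSum (fun n : ℤ × ℤ => x (n.1, n.2 * ν - s)) (if s = 0 then g else 0) := by
  have hν0 : (ν : ℂ) ≠ 0 := Nat.cast_ne_zero.2 hν
  have h1 : HasSum (fun n : ℤ × ℤ => (if (ν : ℤ) ∣ n.2 + s then (1 : ℂ) else 0) • x n)
      (if s = 0 then g else 0) := by
    have h2 := (hasSum_sum fun r (_ : r ∈ Finset.range ν) =>
      (h r).const_smul (unitExp (((s : ℤ) : ℝ) * r / ν))).const_smul (ν : ℂ)⁻¹
    convert h2 using 1
    · ext n
      simp only [smul_smul, ← unitExp_add, ← Finset.sum_smul]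
      congr 1
      have : ∀ r : ℕ, ((s : ℤ) : ℝ) * r / ν + n.2 * r / ν = ((n.2 + s : ℤ) : ℝ) * r / ν :=
        fun r => by push_cast; ring
      simp only [this]
      rw [sum_unitExp_range hν]
      split_ifs <;> simp [hν0]
    · rw [← Finset.sum_smul, sum_unitExp_range hν, smul_smul]
      by_cases h0 : s = 0
      · simp [h0, hν0]
      · rw [if_neg h0, if_neg fun hd => h0 (Nat.eq_zero_of_dvd_of_lt
          (Int.natCast_dvd_natCast.1 hd) hs), mul_zero, zero_smul]
  have hinj : Function.Injective fun n : ℤ × ℤ => (n.1, n.2 * (ν : ℤ) - s) := fun m n hmn => by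
    simp only [Prod.mk.injEq, sub_left_inj, mul_eq_mul_right_iff, Nat.cast_eq_zero, hν,
      or_false] at hmn
    exact Prod.ext hmn.1 hmn.2
  rw [← hinj.hasSum_iff fun n hn => ?_] at h1
  · refine h1.congr_fun fun n => ?_
    simp
  · rw [if_neg, zero_smul]
    rintro ⟨d, hd⟩
    exact hn ⟨(n.1, d), Prod.ext rfl (by simp only; linarith)⟩

lemma hasSum_adjoint_shift {α β : ℝ} (hα : 0 < α) (hβ : 0 < β) {g γ : L2}
    (hframe : IsFrameSeq g (sepLattice α β)) (hγ : IsDualWindow g γ α β) {a : ℝ}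
    (ha : Tr a g ∈ gaborSpan g (sepLattice α β)) :
    HasSum (fun n => unitExp (n.2 * a / α) • (((((α * β)⁻¹ : ℝ) : ℂ) *
      ⟪tf (latPt β⁻¹ α⁻¹ n) γ, g⟫_ℂ) • tf (latPt β⁻¹ α⁻¹ n) g)) g := by
  obtain ⟨A, B, hA, hB, hAB⟩ := hframe
  rw [mem_gaborSpan_iff, Tr_eq_tf] at ha
  have hAB' : ∀ f ∈ gaborModule g α β,
      A * ‖f‖ ^ 2 ≤ ∑' n, ‖⟪tf (latPt α β n) g, f⟫_ℂ‖ ^ 2 ∧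
      ∑' n, ‖⟪tf (latPt α β n) g, f⟫_ℂ‖ ^ 2 ≤ B * ‖f‖ ^ 2 := fun f hf => by
    have := hAB f (mem_gaborSpan_iff.2 hf)
    rw [← (latEquiv hα hβ).tsum_eq] at this
    simpa only [coe_latEquiv] using this
  have hdual := (latEquiv hα hβ).hasSum_iff.2 hγ.2
  simp only [Function.comp_def, coe_latEquiv] at hdual
  have : CompleteSpace (gaborModule g α β) :=
    (Submodule.isClosed_topologicalClosure _).completeSpace_coe
  have hbg : IsBessel (fun n => tf (latPt α β n) g) B :=
    .of_frame (K := gaborModule g α β) hA hB.le (tf_latPt_mem_gaborModule g α β) hAB'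
  obtain ⟨⟨C, hbγ⟩, hrep⟩ := hbg.dual (w := fun n => tf (latPt α β n) γ) hA
    (tf_latPt_mem (mem_gaborSpan_iff.1 hγ.1)) (fun f hf => (hAB' f hf).1)
    (hasSum_dual_shift hdual)
  obtain ⟨R, hR⟩ := IsBessel.exists_frameOp hbg hbγ
  obtain ⟨D, hD⟩ := hbg.exists_adjoint hα hβ
  have hJ := hasSum_janssen hα hβ hD (hD.shift (a, 0)) hR
  rw [hrep R hR _ ha] at hJ
  have hJ' := hJ.mapL (tfInv (a, 0))
  rw [tfInv_tf] at hJ'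
  refine hJ'.congr_fun fun n => ?_
  rw [tf_comm, map_smul, map_smul, tfInv_tf, smul_comm]
  congr 2
  simp only [latPt]
  ring_nf

lemma Tr_nat_mul_mem {g : L2} {α β a : ℝ} (ha : Tr a g ∈ gaborSpan g (sepLattice α β)) (r : ℕ) :
    Tr (r * a) g ∈ gaborSpan g (sepLattice α β) := by
  simp only [mem_gaborSpan_iff, Tr_eq_tf] at ha ⊢
  induction r with
  | zero =>
    have := tf_latPt_mem_gaborModule g α β 0
    simpa [latPt] using this
  | succ r ih =>
    have h := tf_mem_gaborModule ha ih
    rw [tf_tf] at h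
    simpa [unitExp_zero, add_mul, add_comm] using h

end Main

/-- (i) ⇒ (ii) of Theorem 4.4: if `T_{α/ν} g ∈ 𝒢`, then
`(αβ)⁻¹ S_{γ,g} M_{s/α} g = δ_{s,0} g` for `s = 0, …, ν-1`. -/
theorem statement_10 (g : L2) (hg : InS0 g) (α β : ℝ) (hα : 0 < α) (hβ : 0 < β)
    (hframe : IsFrameSeq g (sepLattice α β)) (γ : L2) (hγ : IsDualWindow g γ α β)
    (ν : ℕ) (hν : 1 ≤ ν)
    (hshift : Tr (α / ν) g ∈ gaborSpan g (sepLattice α β)) :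
    ∀ s : ℕ, s < ν →
      HasSum (fun kl : ℤ × ℤ =>
        ((((α * β)⁻¹ : ℝ) : ℂ) *
            ⟪tf ((kl.1 : ℝ) / β, (kl.2 : ℝ) * (ν : ℝ) / α) γ, Mo ((s : ℝ) / α) g⟫_ℂ)
          • tf ((kl.1 : ℝ) / β, (kl.2 : ℝ) * (ν : ℝ) / α) g)
        (if s = 0 then g else 0) := by
  intro s hs
  have hν0 : ν ≠ 0 := Nat.one_le_iff_ne_zero.1 hν
  have h := hasSum_frequency_class hν0 (fun r => by
    refine (hasSum_adjoint_shift hα hβ hframe hγ (Tr_nat_mul_mem hshift r)).congr_fun fun n => ?_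
    congr 2
    field_simp) hs
  have h' := h.mapL (tfL (0, s / α))
  convert h' using 1
  · ext1 n
    have hM : ∀ u : L2, tf (0, s / α) (tf (latPt β⁻¹ α⁻¹ (n.1, n.2 * ν - s)) u) =
        unitExp (s / α * (β⁻¹ * n.1)) • tf (n.1 / β, n.2 * ν / α) u := fun u => by
      rw [tf_tf]
      congr 2
      simp only [latPt, Prod.mk_add_mk, Prod.mk.injEq]
      push_cast
      constructor <;> field_simp <;> ring
    rw [map_smul, tfL_apply, hM, ← inner_tf_tf (0, s / α) _ g, hM, inner_smul_left, smul_smul,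
      conj_unitExp, Mo_eq_tf]
    congr 1
    linear_combination (-((α * β)⁻¹ : ℝ) * ⟪tf (n.1 / β, n.2 * ν / α) γ, tf (0, s / α) g⟫_ℂ) *
      unitExp_neg_mul_self (s / α * (β⁻¹ * n.1))
  · split_ifs with h0
    · subst h0
      rw [Nat.cast_zero, zero_div]
      exact (tf_zero g).symm
    · exact (map_zero _).symm

end
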